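/- arXiv:2407.11175 — 3 statements merged into one kernel-verified Lean document; each statement's English description precedes it below -/
import Mathlib

section
/- Let F = ℚ(A, B, p0, p1, p2, p3, p4, p5) be the field of rational functions in eight independent indeterminates over ℚ. Define a sequence (p_n)_{n≥0} in F by the given initial indeterminates p0, …, p5 and, for n ≥ 0, by the trilinear Boussinesq recurrence p_{n+6} = −(A·p_{n+1}·p_{n+3}·p_{n+5} + B·p_{n+2}·p_{n+3}·p_{n+4} + p_n·p_{n+4}·p_{n+5})/(p_{n+1}·p_{n+2}). Then the recurrence is well defined (no denominator vanishes identically) and every term p_n lies in the Laurent polynomial subring ℤ[A, B, p0, p5][p1^{±1}, p2^{±1}, p3^{±1}, p4^{±1}] of F; in particular, the denominator of each p_n in lowest terms is a monomial in p1, p2, p3, p4. -/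
/-- The field of rational functions `ℚ(A, B, p0, p1, p2, p3, p4, p5)` in eight
independent indeterminates over `ℚ`. -/
abbrev RatFuncField8 : Type := FractionRing (MvPolynomial (Fin 8) ℚ)

/-- The eight indeterminates viewed inside the field:
`v 0 = A`, `v 1 = B`, `v 2 = p0`, `v 3 = p1`, `v 4 = p2`, `v 5 = p3`, `v 6 = p4`, `v 7 = p5`. -/
noncomputable def v8 (i : Fin 8) : RatFuncField8 :=
  algebraMap (MvPolynomial (Fin 8) ℚ) RatFuncField8 (MvPolynomial.X i)

/-- The trilinear Boussinesq recurrence with parameters `A, B` and initial values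
`a0, …, a5`:  `p (n+6) = -(A p(n+1) p(n+3) p(n+5) + B p(n+2) p(n+3) p(n+4)
+ p n p(n+4) p(n+5)) / (p(n+1) p(n+2))`. -/
noncomputable def triBSQ {F : Type*} [Field F] (A B a0 a1 a2 a3 a4 a5 : F) : ℕ → F
  | 0 => a0
  | 1 => a1
  | 2 => a2
  | 3 => a3
  | 4 => a4
  | 5 => a5
  | n + 6 =>
      -(A * triBSQ A B a0 a1 a2 a3 a4 a5 (n + 1) * triBSQ A B a0 a1 a2 a3 a4 a5 (n + 3) *
            triBSQ A B a0 a1 a2 a3 a4 a5 (n + 5) +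
          B * triBSQ A B a0 a1 a2 a3 a4 a5 (n + 2) * triBSQ A B a0 a1 a2 a3 a4 a5 (n + 3) *
            triBSQ A B a0 a1 a2 a3 a4 a5 (n + 4) +
          triBSQ A B a0 a1 a2 a3 a4 a5 n * triBSQ A B a0 a1 a2 a3 a4 a5 (n + 4) *
            triBSQ A B a0 a1 a2 a3 a4 a5 (n + 5)) /
        (triBSQ A B a0 a1 a2 a3 a4 a5 (n + 1) * triBSQ A B a0 a1 a2 a3 a4 a5 (n + 2))

/-- The sequence `(p_n)` in `ℚ(A, B, p0, …, p5)` generated by the trilinear Boussinesq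
recurrence from the indeterminate initial values. -/
noncomputable def genericTriBSQ : ℕ → RatFuncField8 :=
  triBSQ (v8 0) (v8 1) (v8 2) (v8 3) (v8 4) (v8 5) (v8 6) (v8 7)

/-- Replacing `p0, …, p5` by `p1, …, p6` in a family `x = (A, B, p0, …, p5)`. -/
noncomputable def shiftBSQ {F : Type*} [Field F] (x : Fin 8 → F) : Fin 8 → F :=
  ![x 0, x 1, x 3, x 4, x 5, x 6, x 7,
    -(x 0 * x 3 * x 5 * x 7 + x 1 * x 4 * x 5 * x 6 + x 2 * x 6 * x 7) / (x 3 * x 4)]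

/-- The trilinear Boussinesq sequence with data `x = (A, B, p0, …, p5)`. -/
noncomputable def seqBSQ {F : Type*} [Field F] (x : Fin 8 → F) : ℕ → F :=
  triBSQ (x 0) (x 1) (x 2) (x 3) (x 4) (x 5) (x 6) (x 7)

/-- The Laurent ring `ℤ[A, B, p0, p5][p1^{±1}, p2^{±1}, p3^{±1}, p4^{±1}]` inside a field. -/
def laurentBSQ {F : Type*} [Field F] (x : Fin 8 → F) : Subring F :=
  Subring.closure (Set.range x ∪ {(x 3)⁻¹, (x 4)⁻¹, (x 5)⁻¹, (x 6)⁻¹})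

section

variable {F : Type*} [Field F] {x : Fin 8 → F}

lemma seqBSQ_add_six (x : Fin 8 → F) (n : ℕ) :
    seqBSQ x (n + 6) = -(x 0 * seqBSQ x (n + 1) * seqBSQ x (n + 3) * seqBSQ x (n + 5) +
      x 1 * seqBSQ x (n + 2) * seqBSQ x (n + 3) * seqBSQ x (n + 4) +
      seqBSQ x n * seqBSQ x (n + 4) * seqBSQ x (n + 5)) /
        (seqBSQ x (n + 1) * seqBSQ x (n + 2)) := by
  simp only [seqBSQ]
  rw [triBSQ]

lemma seqBSQ_shiftBSQ (x : Fin 8 → F) (n : ℕ) : seqBSQ (shiftBSQ x) n = seqBSQ x (n + 1) := by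
  induction n using Nat.strong_induction_on with
  | _ n ih =>
    match n with
    | 0 | 1 | 2 | 3 | 4 | 5 => simp [seqBSQ, shiftBSQ, triBSQ]
    | n + 6 =>
      rw [seqBSQ_add_six, ih n (by omega), ih (n + 1) (by omega), ih (n + 2) (by omega),
        ih (n + 3) (by omega), ih (n + 4) (by omega), ih (n + 5) (by omega),
        show n + 6 + 1 = (n + 1) + 6 by ring, seqBSQ_add_six x (n + 1)]
      rfl

lemma seqBSQ_iterate_shiftBSQ (x : Fin 8 → F) (k n : ℕ) :
    seqBSQ (shiftBSQ^[k] x) n = seqBSQ x (n + k) := by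
  induction k generalizing x with
  | zero => rfl
  | succ k ih => rw [Function.iterate_succ_apply, ih, seqBSQ_shiftBSQ, add_assoc, add_comm k]

lemma algebraicIndependent_shiftBSQ (hx : AlgebraicIndependent ℤ x) :
    AlgebraicIndependent ℤ (shiftBSQ x) := by
  set w : Fin 7 → F := ![x 0, x 1, x 3, x 4, x 5, x 6, x 7] with hw
  set q : F := -(x 0 * x 3 * x 5 * x 7 + x 1 * x 4 * x 5 * x 6 + x 2 * x 6 * x 7) / (x 3 * x 4)
    with hq
  have hxw : x ∘ (finSuccEquiv' (2 : Fin 8)).symm = fun o ↦ o.elim (x 2) w := by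
    funext o
    rcases o with _ | i
    · rfl
    · fin_cases i <;> rfl
  have hsw : shiftBSQ x ∘ (finSuccEquiv' (7 : Fin 8)).symm = fun o ↦ o.elim q w := by
    funext o
    rcases o with _ | i
    · rfl
    · fin_cases i <;> rfl
  rw [← algebraicIndependent_equiv (finSuccEquiv' (7 : Fin 8)).symm, hsw]
  have hind : AlgebraicIndependent ℤ fun o : Option (Fin 7) ↦ o.elim (x 2) w := by
    rw [← hxw]
    exact (algebraicIndependent_equiv _).2 hx
  rw [AlgebraicIndependent.option_iff] at hind ⊢
  refine ⟨hind.1, fun halg ↦ hind.2 ?_⟩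
  have hmem (i : Fin 7) : IsAlgebraic (Algebra.adjoin ℤ (Set.range w)) (w i) :=
    isAlgebraic_algebraMap (⟨w i, Algebra.subset_adjoin ⟨i, rfl⟩⟩ : Algebra.adjoin ℤ (Set.range w))
  have h0 := hmem 0
  have h1 := hmem 1
  have h3 := hmem 2
  have h4 := hmem 3
  have h5 := hmem 4
  have h6 := hmem 5
  have h7 := hmem 6
  simp only [hw] at h0 h1 h3 h4 h5 h6 h7
  have hne (i : Fin 8) : x i ≠ 0 := hx.ne_zero i
  have key : x 2 = (-(q * (x 3 * x 4)) - (x 0 * x 3 * x 5 * x 7 + x 1 * x 4 * x 5 * x 6)) *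
      (x 6 * x 7)⁻¹ := by
    have := hne 3; have := hne 4; have := hne 6; have := hne 7
    rw [hq]
    field_simp
    ring
  rw [key]
  exact (((halg.mul (h3.mul h4)).neg).sub
    ((((h0.mul h3).mul h5).mul h7).add (((h1.mul h4).mul h5).mul h6))).mul (h6.mul h7).inv

lemma algebraicIndependent_iterate_shiftBSQ (hx : AlgebraicIndependent ℤ x) (k : ℕ) :
    AlgebraicIndependent ℤ (shiftBSQ^[k] x) := by
  induction k with
  | zero => exact hx
  | succ k ih =>
    rw [Function.iterate_succ_apply']
    exact algebraicIndependent_shiftBSQ ih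

lemma seqBSQ_ne_zero (hx : AlgebraicIndependent ℤ x) (n : ℕ) : seqBSQ x n ≠ 0 := by
  have h := seqBSQ_iterate_shiftBSQ x n 0
  rw [zero_add] at h
  rw [← h]
  simpa [seqBSQ, triBSQ] using (algebraicIndependent_iterate_shiftBSQ hx n).ne_zero 2

lemma apply_mem_laurentBSQ (x : Fin 8 → F) (i : Fin 8) : x i ∈ laurentBSQ x :=
  Subring.subset_closure (Or.inl ⟨i, rfl⟩)

lemma inv_mem_laurentBSQ (x : Fin 8 → F) {i : Fin 8} (h3 : 3 ≤ i) (h6 : i ≤ 6) :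
    (x i)⁻¹ ∈ laurentBSQ x := by
  apply Subring.subset_closure
  fin_cases i <;> simp_all

lemma aeval_mem_laurentBSQ (x : Fin 8 → F) (P : MvPolynomial (Fin 8) ℤ) :
    MvPolynomial.aeval x P ∈ laurentBSQ x := by
  induction P using MvPolynomial.induction_on with
  | C a => simp
  | add p q hp hq => simpa using add_mem hp hq
  | mul_X p i hp => simpa using mul_mem hp (apply_mem_laurentBSQ x i)

/-- Elements of a ring generated by elements and inverses acquire, after multiplication by a
power of `m`, values in a subring containing the elements and the products of `m` with the
inverses. -/
lemma exists_mul_pow_mem {s : Set F} {S : Subring F} {m : F} (hm : m ∈ S)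
    (hs : ∀ a ∈ s, ∃ e : ℕ, a * m ^ e ∈ S) {u : F} (hu : u ∈ Subring.closure s) :
    ∃ e : ℕ, u * m ^ e ∈ S := by
  induction hu using Subring.closure_induction with
  | mem a ha => exact hs a ha
  | zero => exact ⟨0, by simp⟩
  | one => exact ⟨0, by simp⟩
  | add a b _ _ ha hb =>
    obtain ⟨e, he⟩ := ha
    obtain ⟨f, hf⟩ := hb
    refine ⟨e + f, ?_⟩
    have : (a + b) * m ^ (e + f) = a * m ^ e * m ^ f + b * m ^ f * m ^ e := by ring
    rw [this]
    exact add_mem (mul_mem he (pow_mem hm f)) (mul_mem hf (pow_mem hm e))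
  | neg a _ ha =>
    obtain ⟨e, he⟩ := ha
    exact ⟨e, by simpa using neg_mem he⟩
  | mul a b _ _ ha hb =>
    obtain ⟨e, he⟩ := ha
    obtain ⟨f, hf⟩ := hb
    refine ⟨e + f, ?_⟩
    have : a * b * m ^ (e + f) = a * m ^ e * (b * m ^ f) := by ring
    rw [this]
    exact mul_mem he hf

/-- A Laurent polynomial in `x` is a polynomial divided by a power of a monomial. -/
lemma exists_aeval_eq_mul_pow (hne : ∀ i, x i ≠ 0) {u : F} (hu : u ∈ laurentBSQ x) :
    ∃ (e : ℕ) (P : MvPolynomial (Fin 8) ℤ),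
      MvPolynomial.aeval x P = u * (x 3 * x 4 * x 5 * x 6) ^ e := by
  refine exists_mul_pow_mem (S := (MvPolynomial.aeval (R := ℤ) x).range.toSubring)
    ⟨MvPolynomial.X 3 * MvPolynomial.X 4 * MvPolynomial.X 5 * MvPolynomial.X 6, by simp⟩ ?_ hu
  have := hne 3
  have := hne 4
  have := hne 5
  have := hne 6
  rintro a (⟨i, rfl⟩ | rfl | rfl | rfl | rfl)
  · exact ⟨0, MvPolynomial.X i, by simp⟩
  · exact ⟨1, MvPolynomial.X 4 * MvPolynomial.X 5 * MvPolynomial.X 6, by simp; field_simp⟩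
  · exact ⟨1, MvPolynomial.X 3 * MvPolynomial.X 5 * MvPolynomial.X 6, by simp; field_simp⟩
  · exact ⟨1, MvPolynomial.X 3 * MvPolynomial.X 4 * MvPolynomial.X 6, by simp; field_simp⟩
  · exact ⟨1, MvPolynomial.X 3 * MvPolynomial.X 4 * MvPolynomial.X 5, by simp; field_simp⟩

lemma prime_X_seven : Prime (MvPolynomial.X 7 : MvPolynomial (Fin 8) ℤ) :=
  MvPolynomial.X_prime

/-- `u` is divisible by `p5` in the Laurent ring. -/
def DvdBSQ (x : Fin 8 → F) (u : F) : Prop := ∃ v ∈ laurentBSQ x, u = x 7 * v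

lemma dvdBSQ_of_dvd_aeval (hne : ∀ i, x i ≠ 0) {u : F} {e : ℕ} {P : MvPolynomial (Fin 8) ℤ}
    (hP : MvPolynomial.aeval x P = u * (x 3 * x 4 * x 5 * x 6) ^ e)
    (hd : MvPolynomial.X 7 ∣ P) : DvdBSQ x u := by
  obtain ⟨Q, rfl⟩ := hd
  refine ⟨MvPolynomial.aeval x Q * ((x 3)⁻¹ * (x 4)⁻¹ * (x 5)⁻¹ * (x 6)⁻¹) ^ e,
    mul_mem (aeval_mem_laurentBSQ x Q) (pow_mem (mul_mem (mul_mem (mul_mem ?_ ?_) ?_) ?_) e), ?_⟩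
  iterate 4 exact inv_mem_laurentBSQ x (by decide) (by decide)
  rw [map_mul, MvPolynomial.aeval_X] at hP
  rw [← mul_assoc, hP, ← mul_inv, ← mul_inv, ← mul_inv, mul_assoc, ← mul_pow,
    mul_inv_cancel₀, one_pow, mul_one]
  simp [hne]

lemma not_X_seven_dvd_pow (e : ℕ) :
    ¬ (MvPolynomial.X 7 : MvPolynomial (Fin 8) ℤ) ∣ (MvPolynomial.X 3 * MvPolynomial.X 4 *
      MvPolynomial.X 5 * MvPolynomial.X 6) ^ e := by
  intro h
  have h := prime_X_seven.dvd_of_dvd_pow h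
  simp only [prime_X_seven.dvd_mul, MvPolynomial.X_dvd_X] at h
  revert h
  decide

/-- The generator `p5` is prime in the Laurent ring. -/
lemma DvdBSQ.or_of_mul (hx : AlgebraicIndependent ℤ x) {u w : F} (hu : u ∈ laurentBSQ x)
    (hw : w ∈ laurentBSQ x) (h : DvdBSQ x (u * w)) : DvdBSQ x u ∨ DvdBSQ x w := by
  have hne : ∀ i, x i ≠ 0 := hx.ne_zero
  obtain ⟨z, hz, h⟩ := h
  obtain ⟨a, P, hP⟩ := exists_aeval_eq_mul_pow hne hu
  obtain ⟨b, Q, hQ⟩ := exists_aeval_eq_mul_pow hne hw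
  obtain ⟨c, R, hR⟩ := exists_aeval_eq_mul_pow hne hz
  have heq : P * Q * (MvPolynomial.X 3 * MvPolynomial.X 4 * MvPolynomial.X 5 *
      MvPolynomial.X 6) ^ c = MvPolynomial.X 7 * (R * (MvPolynomial.X 3 * MvPolynomial.X 4 *
        MvPolynomial.X 5 * MvPolynomial.X 6) ^ (a + b)) := by
    apply (algebraicIndependent_iff_injective_aeval.1 hx)
    simp only [map_mul, map_pow, MvPolynomial.aeval_X, hP, hQ, hR]
    linear_combination (x 3 * x 4 * x 5 * x 6) ^ (a + b + c) * h
  rcases prime_X_seven.dvd_or_dvd (Dvd.intro _ heq.symm) with h | h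
  · rcases prime_X_seven.dvd_or_dvd h with h | h
    · exact .inl (dvdBSQ_of_dvd_aeval hne hP h)
    · exact .inr (dvdBSQ_of_dvd_aeval hne hQ h)
  · exact absurd h (not_X_seven_dvd_pow c)

lemma DvdBSQ.sub {u w : F} (hu : DvdBSQ x u) (hw : DvdBSQ x w) : DvdBSQ x (u - w) := by
  obtain ⟨a, ha, rfl⟩ := hu
  obtain ⟨b, hb, rfl⟩ := hw
  exact ⟨a - b, sub_mem ha hb, by ring⟩

lemma DvdBSQ.mul_right {u w : F} (hu : DvdBSQ x u) (hw : w ∈ laurentBSQ x) :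
    DvdBSQ x (u * w) := by
  obtain ⟨a, ha, rfl⟩ := hu
  exact ⟨a * w, mul_mem ha hw, by ring⟩

lemma not_dvdBSQ_apply (hx : AlgebraicIndependent ℤ x) {i : Fin 8} (hi : i ≠ 7) :
    ¬ DvdBSQ x (x i) := by
  rintro ⟨z, hz, h⟩
  obtain ⟨c, R, hR⟩ := exists_aeval_eq_mul_pow hx.ne_zero hz
  have heq : MvPolynomial.X i * (MvPolynomial.X 3 * MvPolynomial.X 4 * MvPolynomial.X 5 *
      MvPolynomial.X 6) ^ c = MvPolynomial.X 7 * R := by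
    apply (algebraicIndependent_iff_injective_aeval.1 hx)
    simp only [map_mul, map_pow, MvPolynomial.aeval_X, hR]
    linear_combination (x 3 * x 4 * x 5 * x 6) ^ c * h
  rcases prime_X_seven.dvd_or_dvd (Dvd.intro _ heq.symm) with h | h
  · exact hi ((MvPolynomial.X_dvd_X.1 h).symm)
  · exact not_X_seven_dvd_pow c h

lemma not_dvdBSQ_mul (hx : AlgebraicIndependent ℤ x) {u w : F} (hu : u ∈ laurentBSQ x)
    (hw : w ∈ laurentBSQ x) (nu : ¬ DvdBSQ x u) (nw : ¬ DvdBSQ x w) : ¬ DvdBSQ x (u * w) :=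
  fun h ↦ (h.or_of_mul hx hu hw).elim nu nw

/-- An element with a denominator a power of `p5` and another one prime to `p5` is Laurent. -/
lemma mem_laurentBSQ_of_mul_mem (hx : AlgebraicIndependent ℤ x) {y q : F} {d : ℕ}
    (hq : q ∈ laurentBSQ x) (nq : ¬ DvdBSQ x q) (hyd : y * x 7 ^ d ∈ laurentBSQ x)
    (hyq : y * q ∈ laurentBSQ x) : y ∈ laurentBSQ x := by
  induction d with
  | zero => simpa using hyd
  | succ d ih =>
    apply ih
    have h : DvdBSQ x (y * x 7 ^ (d + 1) * q) :=
      ⟨y * q * x 7 ^ d, mul_mem hyq (pow_mem (apply_mem_laurentBSQ x 7) d), by ring⟩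
    obtain ⟨v, hv, h⟩ := (h.or_of_mul hx hyd hq).resolve_right nq
    have : y * x 7 ^ d = v := mul_left_cancel₀ (hx.ne_zero 7) (by rw [← h]; ring)
    rwa [this]

/-- The Laurent ring of shifted data is contained, up to a denominator `m`, in a subring. -/
lemma exists_mul_pow_mem_of_mem_laurentBSQ {S : Subring F} {y : Fin 8 → F} {m : F}
    (hm : m ∈ S) (hy : ∀ i, y i ∈ S) (h3 : (y 3)⁻¹ * m ∈ S) (h4 : (y 4)⁻¹ * m ∈ S)
    (h5 : (y 5)⁻¹ * m ∈ S) (h6 : (y 6)⁻¹ * m ∈ S) {u : F} (hu : u ∈ laurentBSQ y) :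
    ∃ e : ℕ, u * m ^ e ∈ S := by
  refine exists_mul_pow_mem hm ?_ hu
  rintro a (⟨i, rfl⟩ | rfl | rfl | rfl | rfl)
  · exact ⟨0, by simpa using hy i⟩
  all_goals exact ⟨1, by simpa⟩

attribute [irreducible] laurentBSQ

lemma seqBSQ_rec (hx : AlgebraicIndependent ℤ x) (n : ℕ) :
    seqBSQ x (n + 1) * seqBSQ x (n + 2) * seqBSQ x (n + 6) =
      -(x 0 * seqBSQ x (n + 1) * seqBSQ x (n + 3) * seqBSQ x (n + 5) +
        x 1 * seqBSQ x (n + 2) * seqBSQ x (n + 3) * seqBSQ x (n + 4) +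
        seqBSQ x n * seqBSQ x (n + 4) * seqBSQ x (n + 5)) := by
  rw [seqBSQ_add_six x n,
    mul_div_cancel₀ _ (mul_ne_zero (seqBSQ_ne_zero hx _) (seqBSQ_ne_zero hx _))]

/-- The terms `p6, …, p10` are Laurent, and `p6, …, p9` are not divisible by `p5`. -/
lemma seqBSQ_first_terms (hx : AlgebraicIndependent ℤ x) :
    (seqBSQ x 6 ∈ laurentBSQ x ∧ ¬ DvdBSQ x (seqBSQ x 6)) ∧
    (seqBSQ x 7 ∈ laurentBSQ x ∧ ¬ DvdBSQ x (seqBSQ x 7)) ∧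
    (seqBSQ x 8 ∈ laurentBSQ x ∧ ¬ DvdBSQ x (seqBSQ x 8)) ∧
    (seqBSQ x 9 ∈ laurentBSQ x ∧ ¬ DvdBSQ x (seqBSQ x 9)) ∧
    seqBSQ x 10 * seqBSQ x 6 ∈ laurentBSQ x := by
  have hne : ∀ i, x i ≠ 0 := hx.ne_zero
  have m := apply_mem_laurentBSQ x
  have nd (i : Fin 8) (hi : i ≠ 7) : ¬ DvdBSQ x (x i) := not_dvdBSQ_apply hx hi
  have i3 : (x 3)⁻¹ ∈ laurentBSQ x := inv_mem_laurentBSQ x (by decide) (by decide)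
  have i4 : (x 4)⁻¹ ∈ laurentBSQ x := inv_mem_laurentBSQ x (by decide) (by decide)
  have i5 : (x 5)⁻¹ ∈ laurentBSQ x := inv_mem_laurentBSQ x (by decide) (by decide)
  have i6 : (x 6)⁻¹ ∈ laurentBSQ x := inv_mem_laurentBSQ x (by decide) (by decide)
  have n3 := hne 3
  have n4 := hne 4
  have n5 := hne 5
  have n6 := hne 6
  have n7 := hne 7
  have r6 := seqBSQ_rec hx 0
  have r7 := seqBSQ_rec hx 1
  have r8 := seqBSQ_rec hx 2
  have r9 := seqBSQ_rec hx 3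
  have r10 := seqBSQ_rec hx 4
  have e0 : seqBSQ x 0 = x 2 := by simp [seqBSQ, triBSQ]
  have e1 : seqBSQ x 1 = x 3 := by simp [seqBSQ, triBSQ]
  have e2 : seqBSQ x 2 = x 4 := by simp [seqBSQ, triBSQ]
  have e3 : seqBSQ x 3 = x 5 := by simp [seqBSQ, triBSQ]
  have e4 : seqBSQ x 4 = x 6 := by simp [seqBSQ, triBSQ]
  have e5 : seqBSQ x 5 = x 7 := by simp [seqBSQ, triBSQ]
  norm_num only [e0, e1, e2, e3, e4, e5] at r6 r7 r8 r9 r10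
  generalize seqBSQ x 6 = p6 at *
  generalize seqBSQ x 7 = p7 at *
  generalize seqBSQ x 8 = p8 at *
  generalize seqBSQ x 9 = p9 at *
  generalize seqBSQ x 10 = p10 at *
  have m6 : p6 ∈ laurentBSQ x := by
    have : p6 = -(x 0 * x 3 * x 5 * x 7 + x 1 * x 4 * x 5 * x 6 + x 2 * x 6 * x 7) *
        (x 3)⁻¹ * (x 4)⁻¹ := by
      rw [← r6]; field_simp
    rw [this]
    apply_rules [mul_mem, neg_mem, add_mem]
  have m7 : p7 ∈ laurentBSQ x := by
    have : p7 = -(x 0 * x 4 * x 6 * p6 + x 1 * x 5 * x 6 * x 7 + x 3 * x 7 * p6) *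
        (x 4)⁻¹ * (x 5)⁻¹ := by
      rw [← r7]; field_simp
    rw [this]
    apply_rules [mul_mem, neg_mem, add_mem]
  have m8 : p8 ∈ laurentBSQ x := by
    have : p8 = -(x 0 * x 5 * x 7 * p7 + x 1 * x 6 * x 7 * p6 + x 4 * p6 * p7) *
        (x 5)⁻¹ * (x 6)⁻¹ := by
      rw [← r8]; field_simp
    rw [this]
    apply_rules [mul_mem, neg_mem, add_mem]
  have f1 : (x 3 * p6 + x 1 * x 5 * x 6) * x 4 = -x 7 * (x 0 * x 3 * x 5 + x 2 * x 6) := by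
    linear_combination r6
  have f9 : x 6 * p9 * x 4 ^ 2 =
      -(x 1 * p6 * p7 * x 4 ^ 2) - x 7 * p8 * (x 0 * x 3 * x 5 + x 2 * x 6) := by
    apply mul_left_cancel₀ n7
    linear_combination x 4 ^ 2 * r9 - x 4 * p8 * r7 + p8 * x 7 * f1
  have m9 : p9 ∈ laurentBSQ x := by
    have : p9 = (-(x 1 * p6 * p7 * x 4 ^ 2) - x 7 * p8 * (x 0 * x 3 * x 5 + x 2 * x 6)) *
        (x 6)⁻¹ * (x 4)⁻¹ ^ 2 := by
      rw [← f9]; field_simp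
    rw [this]
    apply_rules [mul_mem, neg_mem, add_mem, sub_mem, pow_mem]
  have d6 : ¬ DvdBSQ x p6 := by
    intro h
    have hd : DvdBSQ x (x 1 * x 4 * x 5 * x 6) := by
      have h' : DvdBSQ x (p6 * (-(x 3 * x 4)) -
          x 7 * (x 0 * x 3 * x 5 + x 2 * x 6)) :=
        (h.mul_right (by apply_rules [mul_mem, neg_mem])).sub
          ⟨_, by apply_rules [mul_mem, add_mem], rfl⟩
      convert! h' using 1
      linear_combination r6
    revert hd
    apply_rules [not_dvdBSQ_mul, mul_mem, nd] <;> decide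
  have d7 : ¬ DvdBSQ x p7 := by
    intro h
    have hd : DvdBSQ x (x 0 * x 4 * x 6 * p6) := by
      have h' : DvdBSQ x (p7 * (-(x 4 * x 5)) - x 7 * (x 1 * x 5 * x 6 + x 3 * p6)) :=
        (h.mul_right (by apply_rules [mul_mem, neg_mem])).sub
          ⟨_, by apply_rules [mul_mem, add_mem], rfl⟩
      convert! h' using 1
      linear_combination r7
    revert hd
    apply_rules [not_dvdBSQ_mul, mul_mem, nd] <;> decide
  have d8 : ¬ DvdBSQ x p8 := by
    intro h
    have hd : DvdBSQ x (x 4 * p6 * p7) := by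
      have h' : DvdBSQ x (p8 * (-(x 5 * x 6)) - x 7 * (x 0 * x 5 * p7 + x 1 * x 6 * p6)) :=
        (h.mul_right (by apply_rules [mul_mem, neg_mem])).sub
          ⟨_, by apply_rules [mul_mem, add_mem], rfl⟩
      convert! h' using 1
      linear_combination r8
    revert hd
    apply_rules [not_dvdBSQ_mul, mul_mem, nd]; decide
  have d9 : ¬ DvdBSQ x p9 := by
    intro h
    have hd : DvdBSQ x (x 1 * p6 * p7 * x 4 * x 4) := by
      have h' : DvdBSQ x (p9 * (-(x 6 * x 4 ^ 2)) - x 7 * (p8 * (x 0 * x 3 * x 5 + x 2 * x 6))) :=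
        (h.mul_right (by apply_rules [mul_mem, neg_mem, pow_mem])).sub
          ⟨_, by apply_rules [mul_mem, add_mem], rfl⟩
      convert! h' using 1
      linear_combination f9
    revert hd
    apply_rules [not_dvdBSQ_mul, mul_mem, nd] <;> decide
  refine ⟨⟨m6, d6⟩, ⟨m7, d7⟩, ⟨m8, d8⟩, ⟨m9, d9⟩, ?_⟩
  have f10 : p10 * p6 =
      p8 ^ 2 * (x 0 * x 3 * x 5 + x 2 * x 6) * (x 4)⁻¹ ^ 2 - x 0 * p7 * p9 := by
    have : p10 * p6 * x 4 ^ 2 =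
        p8 ^ 2 * (x 0 * x 3 * x 5 + x 2 * x 6) - x 0 * p7 * p9 * x 4 ^ 2 := by
      apply mul_left_cancel₀ n7
      linear_combination x 4 ^ 2 * r10 - p8 * f9
    field_simp
    linear_combination this
  rw [f10]
  apply_rules [mul_mem, add_mem, sub_mem, pow_mem]

/-- If `p_n` of the shifted data is Laurent, `p_{n+1}` has a power of `p5` as denominator. -/
lemma exists_seqBSQ_succ_mul_pow_mem (hx : AlgebraicIndependent ℤ x) {n : ℕ}
    (h : seqBSQ (shiftBSQ x) n ∈ laurentBSQ (shiftBSQ x)) :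
    ∃ d : ℕ, seqBSQ x (n + 1) * x 7 ^ d ∈ laurentBSQ x := by
  have hq := (seqBSQ_first_terms hx).1.1
  have h7 := hx.ne_zero 7
  have m := apply_mem_laurentBSQ x
  have e6 : shiftBSQ x 7 = seqBSQ x 6 := by
    simp [shiftBSQ, seqBSQ, triBSQ]
  rw [seqBSQ_shiftBSQ] at h
  refine exists_mul_pow_mem_of_mem_laurentBSQ (m 7) (fun i ↦ ?_) ?_ ?_ ?_ ?_ h
  · by_cases hi : i = 7
    · rw [hi, e6]
      exact hq
    · fin_cases i
      · exact m 0
      · exact m 1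
      · exact m 3
      · exact m 4
      · exact m 5
      · exact m 6
      · exact m 7
      · exact absurd rfl hi
  · exact mul_mem (inv_mem_laurentBSQ x (i := 4) (by decide) (by decide)) (m 7)
  · exact mul_mem (inv_mem_laurentBSQ x (i := 5) (by decide) (by decide)) (m 7)
  · exact mul_mem (inv_mem_laurentBSQ x (i := 6) (by decide) (by decide)) (m 7)
  · change (x 7)⁻¹ * x 7 ∈ _
    rw [inv_mul_cancel₀ h7]
    exact one_mem _

lemma seqBSQ_ten_mem (hx : AlgebraicIndependent ℤ x) : seqBSQ x 10 ∈ laurentBSQ x := by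
  obtain ⟨⟨m6, d6⟩, -, -, -, h⟩ := seqBSQ_first_terms hx
  obtain ⟨d, hd⟩ := exists_seqBSQ_succ_mul_pow_mem hx
    (seqBSQ_first_terms (algebraicIndependent_shiftBSQ hx)).2.2.2.1.1
  exact mem_laurentBSQ_of_mul_mem hx m6 d6 hd h

/-- If `p_n` of the five times shifted data is Laurent, `p_{n+5}` has a power of
`p6 * p7 * p8 * p9` as denominator. -/
lemma exists_seqBSQ_add_five_mul_pow_mem (hx : AlgebraicIndependent ℤ x) {n : ℕ}
    (h : seqBSQ (shiftBSQ^[5] x) n ∈ laurentBSQ (shiftBSQ^[5] x)) :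
    ∃ d : ℕ, seqBSQ x (n + 5) *
      (seqBSQ x 6 * seqBSQ x 7 * seqBSQ x 8 * seqBSQ x 9) ^ d ∈ laurentBSQ x := by
  obtain ⟨⟨m6, -⟩, ⟨m7, -⟩, ⟨m8, -⟩, ⟨m9, -⟩, -⟩ := seqBSQ_first_terms hx
  have m10 := seqBSQ_ten_mem hx
  have m := apply_mem_laurentBSQ x
  have n6 := seqBSQ_ne_zero hx 6
  have n7 := seqBSQ_ne_zero hx 7
  have n8 := seqBSQ_ne_zero hx 8
  have n9 := seqBSQ_ne_zero hx 9
  have h0 (k : ℕ) (y : Fin 8 → F) : shiftBSQ^[k] y 0 = y 0 := by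
    induction k generalizing y with
    | zero => rfl
    | succ k ih => rw [Function.iterate_succ_apply, ih]; rfl
  have h1 (k : ℕ) (y : Fin 8 → F) : shiftBSQ^[k] y 1 = y 1 := by
    induction k generalizing y with
    | zero => rfl
    | succ k ih => rw [Function.iterate_succ_apply, ih]; rfl
  have s2 : shiftBSQ^[5] x 2 = x 7 := by
    simpa [seqBSQ, triBSQ] using seqBSQ_iterate_shiftBSQ x 5 0
  have s3 : shiftBSQ^[5] x 3 = seqBSQ x 6 := seqBSQ_iterate_shiftBSQ x 5 1
  have s4 : shiftBSQ^[5] x 4 = seqBSQ x 7 := seqBSQ_iterate_shiftBSQ x 5 2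
  have s5 : shiftBSQ^[5] x 5 = seqBSQ x 8 := seqBSQ_iterate_shiftBSQ x 5 3
  have s6 : shiftBSQ^[5] x 6 = seqBSQ x 9 := seqBSQ_iterate_shiftBSQ x 5 4
  have s7 : shiftBSQ^[5] x 7 = seqBSQ x 10 := seqBSQ_iterate_shiftBSQ x 5 5
  rw [seqBSQ_iterate_shiftBSQ] at h
  refine exists_mul_pow_mem_of_mem_laurentBSQ (by apply_rules [mul_mem]) (fun i ↦ ?_)
    ?_ ?_ ?_ ?_ h
  · fin_cases i
    · exact h0 5 x ▸ m 0
    · exact h1 5 x ▸ m 1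
    · exact s2 ▸ m 7
    · exact s3 ▸ m6
    · exact s4 ▸ m7
    · exact s5 ▸ m8
    · exact s6 ▸ m9
    · exact s7 ▸ m10
  · rw [s3, show (seqBSQ x 6)⁻¹ * (seqBSQ x 6 * seqBSQ x 7 * seqBSQ x 8 * seqBSQ x 9) =
      seqBSQ x 7 * seqBSQ x 8 * seqBSQ x 9 by field_simp]
    apply_rules [mul_mem]
  · rw [s4, show (seqBSQ x 7)⁻¹ * (seqBSQ x 6 * seqBSQ x 7 * seqBSQ x 8 * seqBSQ x 9) =
      seqBSQ x 6 * seqBSQ x 8 * seqBSQ x 9 by field_simp]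
    apply_rules [mul_mem]
  · rw [s5, show (seqBSQ x 8)⁻¹ * (seqBSQ x 6 * seqBSQ x 7 * seqBSQ x 8 * seqBSQ x 9) =
      seqBSQ x 6 * seqBSQ x 7 * seqBSQ x 9 by field_simp]
    apply_rules [mul_mem]
  · rw [s6, show (seqBSQ x 9)⁻¹ * (seqBSQ x 6 * seqBSQ x 7 * seqBSQ x 8 * seqBSQ x 9) =
      seqBSQ x 6 * seqBSQ x 7 * seqBSQ x 8 by field_simp]
    apply_rules [mul_mem]

lemma not_dvdBSQ_pow (hx : AlgebraicIndependent ℤ x) {u : F} (hu : u ∈ laurentBSQ x)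
    (nu : ¬ DvdBSQ x u) (d : ℕ) : ¬ DvdBSQ x (u ^ d) := by
  induction d with
  | zero =>
    intro h
    exact not_dvdBSQ_apply hx (i := 0) (by decide)
      (by simpa using h.mul_right (apply_mem_laurentBSQ x 0))
  | succ d ih =>
    rw [pow_succ]
    exact not_dvdBSQ_mul hx (pow_mem hu d) hu ih nu

/-- The Laurent property for algebraically independent data. -/
lemma seqBSQ_mem_laurentBSQ (hx : AlgebraicIndependent ℤ x) (n : ℕ) :
    seqBSQ x n ∈ laurentBSQ x := by
  induction n using Nat.strong_induction_on generalizing x with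
  | _ n ih =>
    obtain ⟨⟨m6, d6⟩, ⟨m7, d7⟩, ⟨m8, d8⟩, ⟨m9, d9⟩, -⟩ := seqBSQ_first_terms hx
    match n with
    | 0 => simpa [seqBSQ, triBSQ] using apply_mem_laurentBSQ x 2
    | 1 => simpa [seqBSQ, triBSQ] using apply_mem_laurentBSQ x 3
    | 2 => simpa [seqBSQ, triBSQ] using apply_mem_laurentBSQ x 4
    | 3 => simpa [seqBSQ, triBSQ] using apply_mem_laurentBSQ x 5
    | 4 => simpa [seqBSQ, triBSQ] using apply_mem_laurentBSQ x 6
    | n + 5 =>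
      obtain ⟨d, hd⟩ := exists_seqBSQ_succ_mul_pow_mem hx
        (ih (n + 4) (by omega) (algebraicIndependent_shiftBSQ hx))
      obtain ⟨e, he⟩ := exists_seqBSQ_add_five_mul_pow_mem hx
        (ih n (by omega) (algebraicIndependent_iterate_shiftBSQ hx 5))
      have m6789 : seqBSQ x 6 * seqBSQ x 7 * seqBSQ x 8 * seqBSQ x 9 ∈ laurentBSQ x := by
        apply_rules [mul_mem]
      refine mem_laurentBSQ_of_mul_mem hx (pow_mem m6789 e)
        (not_dvdBSQ_pow hx m6789 ?_ e) hd he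
      apply_rules [not_dvdBSQ_mul, mul_mem]

lemma seqBSQ_laurent_of_rat [Algebra ℚ F] (hx : AlgebraicIndependent ℚ x) (n : ℕ) :
    seqBSQ x (n + 1) * seqBSQ x (n + 2) ≠ 0 ∧ seqBSQ x n ∈ laurentBSQ x := by
  have h : AlgebraicIndependent ℤ x := hx.restrictScalars (algebraMap ℤ ℚ).injective_int
  exact ⟨mul_ne_zero (seqBSQ_ne_zero h _) (seqBSQ_ne_zero h _), seqBSQ_mem_laurentBSQ h n⟩

end

lemma algebraicIndependent_v8 : AlgebraicIndependent ℚ v8 := by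
  rw [algebraicIndependent_iff_injective_aeval]
  have : (MvPolynomial.aeval v8 : MvPolynomial (Fin 8) ℚ →ₐ[ℚ] RatFuncField8) =
      IsScalarTower.toAlgHom ℚ (MvPolynomial (Fin 8) ℚ) RatFuncField8 := by
    ext i
    simp [v8]
  rw [this]
  exact IsFractionRing.injective (MvPolynomial (Fin 8) ℚ) RatFuncField8

/-- the generic trilinear Boussinesq recurrence is well defined (no denominator
vanishes) and every term lies in the Laurent polynomial subring
`ℤ[A, B, p0, p5][p1^{±1}, p2^{±1}, p3^{±1}, p4^{±1}]` of `ℚ(A, B, p0, …, p5)`. -/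
theorem stmt_2 :
    ∀ n : ℕ,
      genericTriBSQ (n + 1) * genericTriBSQ (n + 2) ≠ 0 ∧
      genericTriBSQ n ∈
        Subring.closure
          (Set.range v8 ∪ {(v8 3)⁻¹, (v8 4)⁻¹, (v8 5)⁻¹, (v8 6)⁻¹}) := by
  intro n
  have h := seqBSQ_laurent_of_rat algebraicIndependent_v8 n
  rw [laurentBSQ] at h
  exact h
end

section
/- Let F = ℚ(a, b, c, d, x0, x1, x2, x3, y0, y1, y2, z1, z2, z3) be the field of rational functions in fourteen independent indeterminates over ℚ. Define sequences (x_n), (y_n), (z_n) in F by the initial indeterminates x0, x1, x2, x3, y0, y1, y2, z1, z2, z3 and, for each n ≥ 0, computed in the order: y_{n+3} = ((a+b)·x_{n+3}·y_n − a·x_{n+2}·y_{n+1})/(b·x_n), then z_{n+4} = ((a+d)·y_{n+3}·z_{n+1} − a·y_{n+2}·z_{n+2})/(d·y_n), then x_{n+4} = ((a+c)·x_{n+1}·z_{n+4} − a·x_{n+2}·z_{n+3})/(c·z_{n+1}). Then all the iterates are well defined and every x_n, y_n, z_n lies in the Laurent polynomial subring ℤ[a][b^{±1}, c^{±1}, d^{±1}][x0^{±1},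 x1^{±1}, x2^{±1}, x3^{±1}, y0^{±1}, y1^{±1}, y2^{±1}, z1^{±1}, z2^{±1}, z3^{±1}] of F; in particular the denominators in lowest terms are monomials in b, c, d and the ten initial values, and do not depend on a. -/
/-- The state of the ten-dimensional (2,1)-reduction of the higher Gel'fand-Dikii system:
`(x_n, x_{n+1}, x_{n+2}, x_{n+3}, y_n, y_{n+1}, y_{n+2}, z_{n+1}, z_{n+2}, z_{n+3})`. -/
structure GDState (F : Type*) where
  x0 : F
  x1 : F
  x2 : F
  x3 : F
  y0 : F
  y1 : F
  y2 : F
  z1 : F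
  z2 : F
  z3 : F

/-- One step of the ten-dimensional map: compute, in order,
`y_{n+3} = ((a+b) x_{n+3} y_n - a x_{n+2} y_{n+1})/(b x_n)`,
`z_{n+4} = ((a+d) y_{n+3} z_{n+1} - a y_{n+2} z_{n+2})/(d y_n)`,
`x_{n+4} = ((a+c) x_{n+1} z_{n+4} - a x_{n+2} z_{n+3})/(c z_{n+1})`, and shift. -/
noncomputable def GDStep {F : Type*} [Field F] (a b c d : F) (s : GDState F) : GDState F :=
  let y3 := ((a + b) * s.x3 * s.y0 - a * s.x2 * s.y1) / (b * s.x0)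
  let z4 := ((a + d) * y3 * s.z1 - a * s.y2 * s.z2) / (d * s.y0)
  let x4 := ((a + c) * s.x1 * z4 - a * s.x2 * s.z3) / (c * s.z1)
  ⟨s.x1, s.x2, s.x3, x4, s.y1, s.y2, y3, s.z2, s.z3, z4⟩

/-- The field of rational functions `ℚ(a, b, c, d, x0, x1, x2, x3, y0, y1, y2, z1, z2, z3)`
in fourteen independent indeterminates over `ℚ`. -/
abbrev RatFuncField14 : Type := FractionRing (MvPolynomial (Fin 14) ℚ)

/-- The fourteen indeterminates inside the field: `w 0 = a`, `w 1 = b`, `w 2 = c`,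
`w 3 = d`, `w 4, …, w 7 = x0, …, x3`, `w 8, w 9, w 10 = y0, y1, y2`,
`w 11, w 12, w 13 = z1, z2, z3`. -/
noncomputable def w14 (i : Fin 14) : RatFuncField14 :=
  algebraMap (MvPolynomial (Fin 14) ℚ) RatFuncField14 (MvPolynomial.X i)

/-- The Laurent polynomial subring
`ℤ[a][b^{±1}, c^{±1}, d^{±1}][x0^{±1}, …, x3^{±1}, y0^{±1}, y1^{±1}, y2^{±1},
z1^{±1}, z2^{±1}, z3^{±1}]` of `ℚ(a, b, c, d, x0, …, z3)`: the subring generated by all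
the indeterminates together with the inverses of all of them except `a`. -/
noncomputable def gdLaurentRing : Subring RatFuncField14 :=
  Subring.closure (Set.range w14 ∪ ((fun i : Fin 14 => (w14 i)⁻¹) '' {i : Fin 14 | i ≠ 0}))

namespace GDLaurent

open MvPolynomial

/-- Solutions up to index `N` of the non-autonomous Somos-10 recurrence obtained by interleaving
`x_n`, `y_n`, `z_{n+1}` into a single sequence. -/
def IsSolution {E : Type*} [CommRing E] (a : E) (κ u : ℕ → E) (N : ℕ) : Prop :=
  ∀ m, m + 10 < N →
    κ m * u (m + 10) * u m = (a + κ m) * u (m + 9) * u (m + 1) - a * u (m + 6) * u (m + 4)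

/-- The product of all indeterminates except the one standing for `a`. -/
noncomputable def unitMonomial : MvPolynomial (Fin 14) ℤ := ∏ i ∈ Finset.univ.erase 0, X i

/-- The ring of Laurent polynomials, universal for initial data of the recurrence: the variable `0`
is `a`, the variables `1, 2, 3` are the periodic coefficients, the others the initial values. -/
abbrev UnivRing : Type := Localization.Away unitMonomial

lemma unitMonomial_ne_zero : unitMonomial ≠ 0 :=
  Finset.prod_ne_zero_iff.2 fun _ _ => X_ne_zero _

instance : IsDomain UnivRing :=
  IsLocalization.isDomain_localization (powers_le_nonZeroDivisors_of_noZeroDivisors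
    unitMonomial_ne_zero)

/-- The variables of the universal ring. -/
noncomputable def var (i : Fin 14) : UnivRing := algebraMap (MvPolynomial (Fin 14) ℤ) UnivRing (X i)

lemma algebraMap_unitMonomial :
    algebraMap (MvPolynomial (Fin 14) ℤ) UnivRing unitMonomial
      = ∏ i ∈ Finset.univ.erase 0, var i := by
  simp [unitMonomial, var]

lemma isUnit_var {i : Fin 14} (hi : i ≠ 0) : IsUnit (var i) :=
  IsLocalization.Away.isUnit_of_dvd unitMonomial
    (Finset.dvd_prod_of_mem _ (Finset.mem_erase.2 ⟨hi, Finset.mem_univ i⟩))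

section Specialization

variable {E : Type*} [Field E]

/-- Specialization of Laurent polynomials at a point whose coordinates other than `a` do not
vanish. -/
noncomputable def spec (v : Fin 14 → E) (hv : ∀ i ≠ 0, v i ≠ 0) : UnivRing →+* E :=
  IsLocalization.Away.lift (S := UnivRing) unitMonomial
    (g := eval₂Hom (Int.castRingHom E) v) <| by
      simpa [unitMonomial, Finset.prod_eq_zero_iff] using hv

lemma spec_algebraMap (v : Fin 14 → E) (hv : ∀ i ≠ 0, v i ≠ 0) (p : MvPolynomial (Fin 14) ℤ) :
    spec v hv (algebraMap _ UnivRing p) = eval₂Hom (Int.castRingHom E) v p :=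
  IsLocalization.Away.lift_eq _ _ _

@[simp]
lemma spec_var (v : Fin 14 → E) (hv : ∀ i ≠ 0, v i ≠ 0) (i : Fin 14) :
    spec v hv (var i) = v i := by
  simp [var, spec_algebraMap]

lemma map_eval₂Hom_int {S : Type*} [CommRing S] (f : S →+* E) (q : Fin 14 → S)
    (p : MvPolynomial (Fin 14) ℤ) :
    f (eval₂Hom (Int.castRingHom S) q p) = eval₂Hom (Int.castRingHom E) (fun i => f (q i)) p := by
  rw [map_eval₂Hom, Subsingleton.elim (f.comp (Int.castRingHom S)) (Int.castRingHom E)]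

/-- A specialization at a point with coordinates in a subring only needs the inverses of the
coordinates as denominators. -/
lemma exists_spec_mul_pow {S : Type*} [CommRing S] (f : S →+* E) (q : Fin 14 → S)
    {v : Fin 14 → E} (hv : ∀ i ≠ 0, v i ≠ 0) (hvq : ∀ i, v i = f (q i)) (r : UnivRing) :
    ∃ k s, spec v hv r * f (∏ i ∈ Finset.univ.erase 0, q i) ^ k = f s := by
  obtain rfl : v = fun i => f (q i) := funext hvq
  obtain ⟨k, p, hp⟩ := IsLocalization.Away.surj unitMonomial r
  refine ⟨k, eval₂Hom (Int.castRingHom S) q p, ?_⟩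
  have h := congrArg (spec _ hv) hp
  rw [map_mul, map_pow, algebraMap_unitMonomial, map_prod, spec_algebraMap] at h
  simp only [spec_var] at h
  rw [map_prod, h, map_eval₂Hom_int]

/-- The point with coordinates `a`, `κ 0, κ 1, κ 2`, `u 0, …, u 9`. -/
def point {S : Type*} (a : S) (κ u : ℕ → S) (i : Fin 14) : S :=
  if i.val = 0 then a else if i.val ≤ 3 then κ (i.val - 1) else u (i.val - 4)

lemma point_of_ne_zero {S : Type*} (a : S) (κ u : ℕ → S) {i : Fin 14} (hi : i ≠ 0) :
    point a κ u i = if i.val ≤ 3 then κ (i.val - 1) else u (i.val - 4) :=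
  if_neg fun h => hi (Fin.ext h)

lemma point_ne_zero {a : E} {κ u : ℕ → E} (hκ : ∀ m, κ m ≠ 0) (hu : ∀ m < 10, u m ≠ 0)
    (i : Fin 14) (hi : i ≠ 0) : point a κ u i ≠ 0 := by
  have := i.isLt
  rw [point_of_ne_zero a κ u hi]
  split_ifs
  · exact hκ _
  · exact hu _ (by omega)

end Specialization

/-- The universal periodic coefficients. -/
noncomputable def coef (m : ℕ) : UnivRing := var ⟨m % 3 + 1, by omega⟩

lemma isUnit_coef (m : ℕ) : IsUnit (coef m) := isUnit_var (by simp [Fin.ext_iff])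

/-- Universal solutions up to index `N`: they start at the variables of the Laurent ring. -/
structure IsUniversal (r : ℕ → UnivRing) (N : ℕ) : Prop where
  start : ∀ j (hj : j < 10), r j = var ⟨j + 4, by omega⟩
  sol : IsSolution (var 0) coef r N

lemma IsUniversal.mono {r : ℕ → UnivRing} {M N : ℕ} (h : IsUniversal r N) (hMN : M ≤ N) :
    IsUniversal r M :=
  ⟨h.start, fun m hm => h.sol m (by omega)⟩

lemma IsUniversal.isUnit {r : ℕ → UnivRing} {N : ℕ} (h : IsUniversal r N) {j : ℕ} (hj : j < 10) :
    IsUnit (r j) := by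
  rw [h.start j hj]
  exact isUnit_var (by simp [Fin.ext_iff])

section Specialization

variable {E : Type*} [Field E] {a : E} {κ u : ℕ → E}

lemma spec_coef (hper : Function.Periodic κ 3) (hv : ∀ i ≠ 0, point a κ u i ≠ 0) (m : ℕ) :
    spec (point a κ u) hv (coef m) = κ m := by
  rw [coef, spec_var, ← hper.map_mod_nat m]
  have : m % 3 < 3 := Nat.mod_lt _ (by norm_num)
  simp [point]
  omega

/-- Specializing a universal solution at the initial values of a solution yields that solution. -/
lemma IsUniversal.spec_eq {r : ℕ → UnivRing} {N : ℕ} (h : IsUniversal r N)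
    (hper : Function.Periodic κ 3) (hκ : ∀ m, κ m ≠ 0) (hv : ∀ i ≠ 0, point a κ u i ≠ 0)
    (hu : ∀ m, m + 10 < N → u m ≠ 0) (hs : IsSolution a κ u N) :
    ∀ j < N, spec (point a κ u) hv (r j) = u j := by
  intro j
  induction j using Nat.strong_induction_on with
  | _ j ih =>
    intro hj
    rcases lt_or_ge j 10 with h10 | h10
    · rw [h.start j h10, spec_var]
      simp [point]
    · obtain ⟨m, rfl⟩ := Nat.exists_eq_add_of_le' h10
      have h1 := congrArg (spec (point a κ u) hv) (h.sol m hj)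
      simp only [map_mul, map_sub, map_add, spec_coef hper, spec_var] at h1
      rw [ih m (by omega) (by omega), ih (m + 9) (by omega) (by omega),
        ih (m + 1) (by omega) (by omega), ih (m + 6) (by omega) (by omega),
        ih (m + 4) (by omega) (by omega), show point a κ u 0 = a from rfl, ← hs m hj] at h1
      exact mul_left_cancel₀ (hκ m) (mul_right_cancel₀ (hu m hj) h1)

end Specialization

lemma IsUniversal.ne_zero {r : ℕ → UnivRing} {N : ℕ} (h : IsUniversal r N) {j : ℕ} (hj : j < N) :
    r j ≠ 0 := by
  have hv : ∀ i ≠ 0, point (1 : ℚ) (fun _ => 1) (fun _ => 1) i ≠ 0 :=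
    point_ne_zero (by simp) (by simp)
  have := h.spec_eq (E := ℚ) (κ := fun _ => 1) (u := fun _ => 1) (fun _ => rfl) (by simp) hv
    (by simp) (fun m _ => by norm_num) j hj
  rintro h0
  simp [h0] at this

/-- The value at index `10` of a universal solution is prime: it has degree one in the variable
`coef 0`, so the quotient by it embeds in a field by eliminating that variable. -/
lemma IsUniversal.prime_ten {r : ℕ → UnivRing} {N : ℕ} (h : IsUniversal r N) (hN : 10 < N) :
    Prime (r 10) := by
  have h0 := h.sol 0 hN
  simp only [zero_add] at h0
  have h91 : IsUnit (r 9 * r 1) := (h.isUnit (by norm_num)).mul (h.isUnit (by norm_num))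
  obtain ⟨e, he⟩ := h91.exists_left_inv
  set ρ : UnivRing := var 0 * (r 6 * r 4 - r 9 * r 1) * e with hρ
  have hρe : ρ * (r 9 * r 1) = var 0 * (r 6 * r 4 - r 9 * r 1) := by
    linear_combination var 0 * (r 6 * r 4 - r 9 * r 1) * he
  have hρ0 : ρ ≠ 0 := by
    intro hz
    rw [hz, zero_mul, h.start 6 (by norm_num), h.start 4 (by norm_num), h.start 9 (by norm_num),
      h.start 1 (by norm_num)] at hρe
    have h2 := congrArg (spec (fun i => if i = 10 then (2 : ℚ) else 1)
      (fun i _ => by split_ifs <;> norm_num)) hρe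
    simp only [map_zero, map_mul, map_sub, spec_var] at h2
    norm_num [Fin.ext_iff] at h2
  have hdvd : r 10 ∣ ρ - coef 0 := by
    refine ⟨-(coef 0 * r 0 * e), ?_⟩
    linear_combination (coef 0 - ρ) * he + e * h0 + e * hρe
  let q : Fin 14 → UnivRing := Function.update var 1 ρ
  let ι := algebraMap UnivRing (FractionRing UnivRing)
  have hι : Function.Injective ι := IsFractionRing.injective _ _
  have hv : ∀ i ≠ 0, ι (q i) ≠ 0 := by
    intro i hi
    rw [Ne, map_eq_zero_iff ι hι]
    rcases eq_or_ne i 1 with rfl | h1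
    · simpa [q] using hρ0
    · simpa [q, h1] using (isUnit_var hi).ne_zero
  let ψ := spec (fun i => ι (q i)) hv
  have hψu : ∀ j < 10, ψ (r j) = ι (r j) := by
    intro j hj
    simp [ψ, q, h.start j hj, Function.update_apply, Fin.ext_iff]
  have hψ10 : ψ (r 10) = 0 := by
    have h1 := congrArg ψ h0
    have hc : ψ (coef 0) = ι ρ := by simp [ψ, q, coef]
    have ha : ψ (var 0) = ι (var 0) := by simp [ψ, q]
    simp only [map_mul, map_sub, map_add, hc, ha, hψu 0 (by norm_num), hψu 9 (by norm_num),
      hψu 1 (by norm_num), hψu 6 (by norm_num), hψu 4 (by norm_num)] at h1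
    have h2 := congrArg ι hρe
    simp only [map_mul, map_sub] at h2
    have h3 : ι ρ * ι (r 0) * ψ (r 10) = 0 := by linear_combination h1 + h2
    refine (mul_eq_zero.1 h3).resolve_left (mul_ne_zero ?_ ?_)
    · rwa [Ne, map_eq_zero_iff ι hι]
    · rw [Ne, map_eq_zero_iff ι hι]
      exact h.ne_zero (by omega)
  have hker : RingHom.ker ψ = Ideal.span {r 10} := by
    apply le_antisymm
    · intro f hf
      rw [RingHom.mem_ker] at hf
      obtain ⟨k, p, hp⟩ := IsLocalization.Away.surj unitMonomial f
      have h1 : eval₂Hom (Int.castRingHom UnivRing) q p = 0 := by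
        apply hι
        have h2 := congrArg ψ hp
        rw [map_mul, hf, zero_mul, spec_algebraMap] at h2
        rw [map_zero, h2, map_eval₂Hom_int]
      have h3 : (Ideal.Quotient.mk (Ideal.span {r 10})) (algebraMap _ UnivRing p) = 0 := by
        rw [← map_zero (Ideal.Quotient.mk (Ideal.span {r 10})), ← h1]
        have h4 : (Ideal.Quotient.mk (Ideal.span {r 10})).comp
              (algebraMap (MvPolynomial (Fin 14) ℤ) UnivRing)
            = (Ideal.Quotient.mk (Ideal.span {r 10})).comp
              (eval₂Hom (Int.castRingHom UnivRing) q) := by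
          refine MvPolynomial.ringHom_ext (fun n => by simp) fun i => ?_
          rcases eq_or_ne i 1 with rfl | hi
          · symm
            simp only [RingHom.comp_apply, eval₂Hom_X', q, Function.update_self,
              Ideal.Quotient.eq, Ideal.mem_span_singleton]
            exact hdvd
          · simp [q, hi, var]
        exact congrArg (fun g => g p) h4
      rw [Ideal.Quotient.eq_zero_iff_mem, ← hp] at h3
      exact (Ideal.unit_mul_mem_iff_mem _ (IsLocalization.Away.algebraMap_pow_isUnit
        unitMonomial k)).1 (by rwa [mul_comm])
    · rw [Ideal.span_singleton_le_iff_mem, RingHom.mem_ker, hψ10]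
  rw [← Ideal.span_singleton_prime (h.ne_zero hN), ← hker]
  exact RingHom.ker_isPrime ψ

/-- The numerator of the value at index `20` after cancelling the value at index `10`. -/
def confinedNumerator {E : Type*} [CommRing E] (a : E) (κ r : ℕ → E) : E :=
  -(a * (a + κ 1) * κ 0 * r 0 * r 5 * r 7 * r 13 * r 15)
    + (a + κ 1) * r 4 * r 6 * ((a + κ 0) * (a + κ 1) * r 18 * r 10 * r 2
        - a * (a + κ 0) * r 18 * r 7 * r 5 - a * (a + κ 1) * r 15 * r 13 * r 2)
    - a * r 1 * r 9 * (a ^ 2 * r 8 * r 12 * r 10 - a * (a + κ 1) * r 13 * r 5 * r 12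
        - a * (a + κ 0) * r 8 * r 15 * r 7)

/-- The singularity at a zero of the value at index `10` is confined. -/
lemma IsSolution.confinement {E : Type*} [CommRing E] {a : E} {κ r : ℕ → E}
    (hper : Function.Periodic κ 3) (h : IsSolution a κ r 20) :
    κ 0 * κ 1 * (r 1 * r 9 * r 4 * r 6) * ((a + κ 1) * r 19 * r 11 - a * r 16 * r 14)
      = r 10 * confinedNumerator a κ r := by
  have h0 := h 0 (by norm_num)
  have h1 := h 1 (by norm_num)
  have h4 := h 4 (by norm_num)
  have h6 := h 6 (by norm_num)
  have h9 := h 9 (by norm_num)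
  rw [show κ 4 = κ 1 from hper 1] at h4
  rw [show κ 6 = κ 0 from (hper 3).trans (hper 0)] at h6
  rw [show κ 9 = κ 0 from ((hper 6).trans (hper 3)).trans (hper 0)] at h9
  norm_num at h0 h1 h4 h6 h9
  unfold confinedNumerator
  linear_combination (a + κ 1) * r 4 * r 6 * (κ 1 * r 11 * r 1 * h9
      + ((a + κ 0) * r 18 * r 10 - a * r 15 * r 13) * h1)
    - a * r 1 * r 9 * (κ 1 * r 14 * r 4 * h6
      + ((a + κ 0) * r 15 * r 7 - a * r 12 * r 10) * h4)
    + a * (a + κ 1) * r 5 * r 7 * r 13 * r 15 * h0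

lemma coef_periodic : Function.Periodic coef 3 := fun m => by simp [coef]

/-- A universal solution up to index `21` has no factor in common with its value at index `10`
at the indices from `11` to `20`. -/
lemma IsUniversal.not_ten_dvd {r : ℕ → UnivRing} (h : IsUniversal r 21) {j : ℕ} (hj : 11 ≤ j)
    (hj' : j < 21) : ¬ r 10 ∣ r j := by
  let u : ℕ → ℚ := fun n => ([1, 1, 1, 1, 1, 1, 2, 1, 1, 1, 0, -1, -4, -9, -18, -71, -71, -151,
    -374, -639] : List ℚ).getD n 0
  have hu : ∀ m < 10, u m ≠ 0 := by
    intro m hm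
    interval_cases m <;> norm_num [u]
  have hκ : ∀ m : ℕ, (fun _ => 1 : ℕ → ℚ) m ≠ 0 := fun _ => one_ne_zero
  have hv := point_ne_zero (a := (1 : ℚ)) hκ hu
  have h20 := h.mono (show 20 ≤ 21 by norm_num)
  have hχ := h20.spec_eq (a := (1 : ℚ)) (fun _ => rfl) hκ hv (fun m hm => hu m (by omega))
    (fun m hm => by
      have : m < 10 := by omega
      interval_cases m <;> norm_num [u])
  set χ := spec (point 1 (fun _ => 1) u) hv
  rintro ⟨s, hs⟩
  have hz : χ (r j) = 0 := by
    rw [hs, map_mul, hχ 10 (by norm_num)]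
    simp [u]
  rcases Nat.lt_succ_iff_lt_or_eq.1 hj' with hj'' | rfl
  · rw [hχ j hj''] at hz
    interval_cases j <;> norm_num [u] at hz
  · have h1 := h.sol 10 (by norm_num)
    have h2 := h20.sol.confinement coef_periodic
    rw [show coef 10 = coef 1 from ((coef_periodic 7).trans (coef_periodic 4)).trans
      (coef_periodic 1)] at h1
    norm_num at h1
    have h3 : coef 0 * coef 1 * (r 1 * r 9 * r 4 * r 6) * (coef 1 * r 20)
        = confinedNumerator (var 0) coef r := by
      apply mul_left_cancel₀ (h.ne_zero (show 10 < 21 by norm_num))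
      rw [← h2]
      linear_combination coef 0 * coef 1 * (r 1 * r 9 * r 4 * r 6) * h1
    have h4 := congrArg χ h3
    have hc : ∀ m, χ (coef m) = 1 := spec_coef (fun _ => rfl) hv
    have ha : χ (var 0) = 1 := spec_var _ _ _
    rw [map_mul, map_mul χ (coef 1), hz] at h4
    simp only [confinedNumerator, map_mul, map_sub, map_add, map_neg, map_pow, hc, ha,
      hχ 0 (by norm_num), hχ 1 (by norm_num), hχ 2 (by norm_num), hχ 4 (by norm_num),
      hχ 5 (by norm_num), hχ 6 (by norm_num), hχ 7 (by norm_num), hχ 8 (by norm_num),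
      hχ 9 (by norm_num), hχ 10 (by norm_num), hχ 12 (by norm_num), hχ 13 (by norm_num),
      hχ 15 (by norm_num), hχ 18 (by norm_num)] at h4
    norm_num [u] at h4

lemma IsUniversal.update {r : ℕ → UnivRing} {N : ℕ} (h : IsUniversal r (N + 10)) {s : UnivRing}
    (hs : coef N * s * r N
      = (var 0 + coef N) * r (N + 9) * r (N + 1) - var 0 * r (N + 6) * r (N + 4)) :
    IsUniversal (Function.update r (N + 10) s) (N + 11) := by
  refine ⟨fun j hj => ?_, fun m hm => ?_⟩
  · rw [Function.update_of_ne (by omega), h.start j hj]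
  · rcases eq_or_ne m N with rfl | hmN
    · simpa [Function.update_apply] using hs
    · have := h.sol m (by omega)
      simpa [Function.update_apply, hmN, show m ≠ N + 10 by omega, show m ≠ N + 9 by omega,
        show m ≠ N + 1 by omega, show m ≠ N + 6 by omega, show m ≠ N + 4 by omega] using this

lemma exists_isUniversal_of_le {n : ℕ} (hn : n ≤ 10) : ∃ r, IsUniversal r (n + 10) := by
  induction n with
  | zero =>
    refine ⟨fun j => if hj : j < 10 then var ⟨j + 4, by omega⟩ else 0, fun j hj => dif_pos hj,
      fun m hm => by omega⟩
  | succ n ih =>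
    obtain ⟨r, hr⟩ := ih (by omega)
    obtain ⟨e, he⟩ := ((isUnit_coef n).mul (hr.isUnit (show n < 10 by omega))).exists_left_inv
    exact ⟨_, hr.update (s := e * ((var 0 + coef n) * r (n + 9) * r (n + 1)
      - var 0 * r (n + 6) * r (n + 4))) (by
        linear_combination ((var 0 + coef n) * r (n + 9) * r (n + 1)
          - var 0 * r (n + 6) * r (n + 4)) * he)⟩

lemma exists_isUniversal_twentyOne : ∃ r, IsUniversal r 21 := by
  obtain ⟨r, hr⟩ := exists_isUniversal_of_le le_rfl
  have h := hr.sol.confinement coef_periodic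
  have hu : IsUnit (coef 0 * coef 1 * (r 1 * r 9 * r 4 * r 6)) :=
    ((isUnit_coef 0).mul (isUnit_coef 1)).mul ((((hr.isUnit (by norm_num)).mul
      (hr.isUnit (by norm_num))).mul (hr.isUnit (by norm_num))).mul (hr.isUnit (by norm_num)))
  obtain ⟨e, he⟩ := hu.exists_left_inv
  obtain ⟨f, hf⟩ := (isUnit_coef 10).exists_left_inv
  have h10 : coef 10 = coef 1 := ((coef_periodic 7).trans (coef_periodic 4)).trans
    (coef_periodic 1)
  refine ⟨_, hr.update (s := f * e * confinedNumerator (var 0) coef r) ?_⟩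
  rw [h10] at hf ⊢
  norm_num
  linear_combination e * confinedNumerator (var 0) coef r * r 10 * hf - e * h
    + ((var 0 + coef 1) * r 19 * r 11 - var 0 * r 16 * r 14) * he

/-- If `r` is universal up to `N + 10`, its continuation in the fraction field may be computed by
specializing `r` at any of its windows with index at most `11`. -/
lemma IsUniversal.exists_window_denominator {r : ℕ → UnivRing} {N : ℕ}
    (h : IsUniversal r (N + 10)) (hN : 11 ≤ N) {w : FractionRing UnivRing}
    (hw : algebraMap UnivRing (FractionRing UnivRing) (coef N) * w * algebraMap _ _ (r N)
      = algebraMap UnivRing (FractionRing UnivRing)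
        ((var 0 + coef N) * r (N + 9) * r (N + 1) - var 0 * r (N + 6) * r (N + 4)))
    {k : ℕ} (hk : 1 ≤ k) (hk' : k ≤ 11) :
    ∃ e s, w * algebraMap UnivRing (FractionRing UnivRing) (∏ i ∈ Finset.univ.erase 0,
      point (var 0) (fun m => coef (m + k)) (fun m => r (m + k)) i) ^ e
        = algebraMap UnivRing (FractionRing UnivRing) s := by
  set ι := algebraMap UnivRing (FractionRing UnivRing)
  have hι : Function.Injective ι := IsFractionRing.injective _ _
  set T : ℕ → FractionRing UnivRing := Function.update (fun m => ι (r m)) (N + 10) w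
  have hTr : ∀ m < N + 10, T m = ι (r m) := fun m hm => Function.update_of_ne (by omega) _ _
  have hTw : T (N + 10) = w := Function.update_self _ _ _
  have hT0 : ∀ m < N + 10, T m ≠ 0 := by
    intro m hm
    rw [hTr m hm, Ne, map_eq_zero_iff ι hι]
    exact h.ne_zero hm
  have hTsol : IsSolution (ι (var 0)) (fun m => ι (coef m)) T (N + 11) := by
    intro m hm
    rw [hTr m (by omega), hTr (m + 9) (by omega), hTr (m + 1) (by omega),
      hTr (m + 6) (by omega), hTr (m + 4) (by omega)]
    rcases eq_or_ne m N with rfl | hmN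
    · rw [hTw, hw]
      simp only [map_mul, map_sub, map_add]
    · rw [hTr (m + 10) (by omega)]
      simpa only [map_mul, map_sub, map_add] using congrArg ι (h.sol m (by omega))
  have hκ : ∀ m, ι (coef (m + k)) ≠ 0 := fun m =>
    (map_ne_zero_iff ι hι).2 (isUnit_coef _).ne_zero
  have hv := point_ne_zero (a := ι (var 0)) (κ := fun m => ι (coef (m + k)))
    (u := fun m => T (m + k)) hκ (fun m hm => hT0 _ (by omega))
  have hspec := (h.mono (show N + 11 - k ≤ N + 10 by omega)).spec_eq
    (fun m => congrArg ι (by rw [add_right_comm, coef_periodic])) hκ hv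
    (fun m hm => hT0 _ (by omega))
    (fun m hm => by
      have := hTsol (m + k) (by omega)
      simpa only [add_right_comm] using this)
    (N + 10 - k) (by omega)
  simp only [Nat.sub_add_cancel (show k ≤ N + 10 by omega), hTw] at hspec
  rw [← hspec]
  refine exists_spec_mul_pow ι _ hv (fun i => ?_) _
  have hi := i.isLt
  simp only [point]
  split_ifs
  · rfl
  · rfl
  · exact hTr _ (by omega)

lemma IsUniversal.exists_succ {r : ℕ → UnivRing} {N : ℕ} (h : IsUniversal r (N + 10))
    (hN : 11 ≤ N) : ∃ r', IsUniversal r' (N + 11) := by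
  let ι := algebraMap UnivRing (FractionRing UnivRing)
  have hι : Function.Injective ι := IsFractionRing.injective _ _
  have hc : ι (coef N) ≠ 0 := (map_ne_zero_iff ι hι).2 (isUnit_coef _).ne_zero
  have hr : ι (r N) ≠ 0 := (map_ne_zero_iff ι hι).2 (h.ne_zero (by omega))
  obtain ⟨w, hw⟩ : ∃ w, ι (coef N) * w * ι (r N)
      = ι ((var 0 + coef N) * r (N + 9) * r (N + 1) - var 0 * r (N + 6) * r (N + 4)) :=
    ⟨_ / (ι (coef N) * ι (r N)), by rw [mul_right_comm, mul_div_cancel₀ _ (mul_ne_zero hc hr)]⟩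
  obtain ⟨k, s, hs : w * ι _ ^ _ = ι _⟩ := h.exists_window_denominator hN hw le_rfl (by norm_num)
  obtain ⟨l, t, ht : w * ι _ ^ _ = ι _⟩ :=
    h.exists_window_denominator hN hw (show 1 ≤ 11 by norm_num) le_rfl
  have hp : Prime (r 10) := h.prime_ten (by omega)
  set P := ∏ i ∈ Finset.univ.erase 0,
    point (var 0) (fun m => coef (m + 1)) (fun m => r (m + 1)) i
  set Q := ∏ i ∈ Finset.univ.erase 0,
    point (var 0) (fun m => coef (m + 11)) (fun m => r (m + 11)) i
  obtain ⟨c, hcu, hPc⟩ : ∃ c, IsUnit c ∧ P = c * r 10 := by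
    refine ⟨_, ?_, (Finset.prod_erase_mul _ _ (show (13 : Fin 14) ∈ _ by simp)).symm⟩
    refine Finset.prod_induction _ IsUnit (fun _ _ => IsUnit.mul) isUnit_one fun i hi => ?_
    simp only [Finset.mem_erase, Finset.mem_univ, and_true] at hi
    have := i.isLt
    have h13 : i.val ≠ 13 := Fin.val_ne_of_ne hi.1
    rw [point_of_ne_zero _ _ _ hi.2]
    split_ifs
    · exact isUnit_coef _
    · exact h.isUnit (by omega)
  have hpQ : ¬ r 10 ∣ Q := by
    intro hd
    obtain ⟨i, hi, hd⟩ := hp.exists_mem_finset_dvd hd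
    simp only [Finset.mem_erase, Finset.mem_univ, and_true] at hi
    have := i.isLt
    rw [point_of_ne_zero _ _ _ hi] at hd
    split_ifs at hd
    · exact hp.not_isUnit (isUnit_of_dvd_unit hd (isUnit_coef _))
    · exact (h.mono (show 21 ≤ N + 10 by omega)).not_ten_dvd (by omega) (by omega) hd
  have hst : s * Q ^ l = t * P ^ k := by
    apply hι
    simp only [map_mul, map_pow]
    linear_combination ι P ^ k * ht - ι Q ^ l * hs
  obtain ⟨y, rfl⟩ : r 10 ^ k ∣ s := by
    refine hp.pow_dvd_of_dvd_mul_right k (b := Q ^ l) (fun hd => hpQ (hp.dvd_of_dvd_pow hd)) ?_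
    exact ⟨t * c ^ k, by rw [hst, hPc]; ring⟩
  obtain ⟨e, he⟩ := hcu.exists_left_inv
  have hwy : w = ι (y * e ^ k) := by
    have hr10 : ι (r 10) ^ k ≠ 0 := pow_ne_zero _ ((map_ne_zero_iff ι hι).2 hp.ne_zero)
    have he' : ι e ^ k * ι c ^ k = 1 := by
      rw [← mul_pow, ← map_mul, he, map_one, one_pow]
    apply mul_left_cancel₀ hr10
    rw [hPc] at hs
    simp only [map_mul, map_pow, mul_pow] at hs ⊢
    linear_combination ι e ^ k * hs - ι (r 10) ^ k * w * he'
  refine ⟨_, h.update (s := y * e ^ k) (hι ?_)⟩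
  rw [map_mul, map_mul ι (coef N), ← hwy, hw]

theorem exists_isUniversal (n : ℕ) : ∃ r, IsUniversal r (n + 10) := by
  induction n with
  | zero => exact exists_isUniversal_of_le (by norm_num)
  | succ n ih =>
    rcases lt_trichotomy n 10 with hn | rfl | hn
    · exact exists_isUniversal_of_le hn
    · exact exists_isUniversal_twentyOne
    · obtain ⟨r, hr⟩ := ih
      exact hr.exists_succ hn

/-- The order in which the interleaved sequence uses the indeterminates of the field. -/
def interleave : Fin 14 → Fin 14 := ![0, 1, 3, 2, 4, 8, 11, 5, 9, 12, 6, 10, 13, 7]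

lemma interleave_injective : Function.Injective interleave := by
  decide

lemma w14_ne_zero (i : Fin 14) : w14 i ≠ 0 :=
  (map_ne_zero_iff _ (IsFractionRing.injective _ _)).2 (X_ne_zero i)

/-- The embedding of the universal ring in the field of rational functions. -/
noncomputable def toField : UnivRing →+* RatFuncField14 :=
  spec (fun i => w14 (interleave i)) fun _ _ => w14_ne_zero _

lemma toField_injective : Function.Injective toField := by
  rw [injective_iff_map_eq_zero]
  intro f hf
  obtain ⟨k, p, hp⟩ := IsLocalization.Away.surj unitMonomial f
  have h : eval₂Hom (Int.castRingHom RatFuncField14) (fun i => w14 (interleave i))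
      = (algebraMap (MvPolynomial (Fin 14) ℚ) RatFuncField14).comp
        ((rename interleave : MvPolynomial (Fin 14) ℚ →ₐ[ℚ] _).toRingHom.comp
          (MvPolynomial.map (Int.castRingHom ℚ))) :=
    MvPolynomial.ringHom_ext (fun n => by simp) fun i => by simp [w14]
  have h0 := congrArg toField hp
  rw [map_mul, hf, zero_mul, toField, spec_algebraMap, h] at h0
  have hp0 : p = 0 := by
    refine map_injective _ (RingHom.injective_int (Int.castRingHom ℚ))
      (rename_injective _ interleave_injective (IsFractionRing.injective _ RatFuncField14 ?_))
    simpa using h0.symm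
  rw [hp0, map_zero] at hp
  exact (IsLocalization.Away.algebraMap_pow_isUnit unitMonomial k).mul_left_eq_zero.1 hp

lemma toField_mem (f : UnivRing) : toField f ∈ gdLaurentRing := by
  have hmem : ∀ i, w14 i ∈ gdLaurentRing := fun i =>
    Subring.subset_closure (Or.inl ⟨i, rfl⟩)
  have hinv : ∀ i ≠ 0, (w14 i)⁻¹ ∈ gdLaurentRing := fun i hi =>
    Subring.subset_closure (Or.inr ⟨i, hi, rfl⟩)
  obtain ⟨k, s, hs⟩ := exists_spec_mul_pow gdLaurentRing.subtype
    (fun i => ⟨w14 (interleave i), hmem _⟩) (fun i _ => w14_ne_zero (interleave i))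
    (fun i => rfl) f
  rw [map_prod] at hs
  change toField f * (∏ i ∈ Finset.univ.erase 0, w14 (interleave i)) ^ k = s at hs
  have hne : (∏ i ∈ Finset.univ.erase 0, w14 (interleave i)) ≠ 0 :=
    Finset.prod_ne_zero_iff.2 fun _ _ => w14_ne_zero _
  rw [(eq_mul_inv_iff_mul_eq₀ (pow_ne_zero k hne)).2 hs, ← inv_pow, ← Finset.prod_inv_distrib]
  refine mul_mem s.2 (pow_mem (prod_mem fun i hi => hinv _ ?_) k)
  exact fun h0 => (Finset.mem_erase.1 hi).1 (interleave_injective h0)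

lemma gdStep_eq {F : Type*} [Field F] {a b c d x0 x1 x2 x3 x4 y0 y1 y2 y3 z1 z2 z3 z4 : F}
    (hb : b ≠ 0) (hc : c ≠ 0) (hd : d ≠ 0) (hx : x0 ≠ 0) (hy : y0 ≠ 0) (hz : z1 ≠ 0)
    (h3 : b * y3 * x0 = (a + b) * x3 * y0 - a * x2 * y1)
    (h4 : d * z4 * y0 = (a + d) * y3 * z1 - a * y2 * z2)
    (h5 : c * x4 * z1 = (a + c) * x1 * z4 - a * x2 * z3) :
    GDStep a b c d ⟨x0, x1, x2, x3, y0, y1, y2, z1, z2, z3⟩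
      = ⟨x1, x2, x3, x4, y1, y2, y3, z2, z3, z4⟩ := by
  have e3 : ((a + b) * x3 * y0 - a * x2 * y1) / (b * x0) = y3 := by
    rw [← h3]
    field_simp
  have e4 : ((a + d) * y3 * z1 - a * y2 * z2) / (d * y0) = z4 := by
    rw [← h4]
    field_simp
  have e5 : ((a + c) * x1 * z4 - a * x2 * z3) / (c * z1) = x4 := by
    rw [← h5]
    field_simp
  simp only [GDStep, e3, e4, e5]

/-- The iterates of the map interleave to the image of a universal solution. -/
lemma IsUniversal.iterate_gdStep {r : ℕ → UnivRing} {N : ℕ} (h : IsUniversal r N) (n : ℕ)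
    (hn : 3 * n + 10 ≤ N) :
    (GDStep (w14 0) (w14 1) (w14 2) (w14 3))^[n]
        ⟨w14 4, w14 5, w14 6, w14 7, w14 8, w14 9, w14 10, w14 11, w14 12, w14 13⟩
      = ⟨toField (r (3 * n)), toField (r (3 * n + 3)), toField (r (3 * n + 6)),
        toField (r (3 * n + 9)), toField (r (3 * n + 1)), toField (r (3 * n + 4)),
        toField (r (3 * n + 7)), toField (r (3 * n + 2)), toField (r (3 * n + 5)),
        toField (r (3 * n + 8))⟩ := by
  induction n with
  | zero =>
    have hi : ∀ j (hj : j < 10), toField (r j) = w14 (interleave ⟨j + 4, by omega⟩) :=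
      fun j hj => by rw [h.start j hj, toField, spec_var]
    simp only [Function.iterate_zero, id, mul_zero, zero_add, hi 0 (by norm_num),
      hi 1 (by norm_num), hi 2 (by norm_num), hi 3 (by norm_num), hi 4 (by norm_num),
      hi 5 (by norm_num), hi 6 (by norm_num), hi 7 (by norm_num), hi 8 (by norm_num),
      hi 9 (by norm_num)]
    rfl
  | succ n ih =>
    have hne : ∀ j < N, toField (r j) ≠ 0 := fun j hj =>
      (map_ne_zero_iff _ toField_injective).2 (h.ne_zero hj)
    have ha : toField (var 0) = w14 0 := spec_var _ _ _
    have hc : ∀ m, toField (coef m) = w14 (interleave ⟨m % 3 + 1, by omega⟩) := fun m =>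
      spec_var _ _ _
    have hb : toField (coef (3 * n)) = w14 1 := by
      simp only [hc, Nat.mul_mod_right]
      rfl
    have hd : toField (coef (3 * n + 1)) = w14 3 := by
      simp only [hc, Nat.mul_add_mod]
      rfl
    have hcc : toField (coef (3 * n + 2)) = w14 2 := by
      simp only [hc, Nat.mul_add_mod]
      rfl
    have h0 := congrArg toField (h.sol (3 * n) (by omega))
    have h1 := congrArg toField (h.sol (3 * n + 1) (by omega))
    have h2 := congrArg toField (h.sol (3 * n + 2) (by omega))
    simp only [map_mul, map_sub, map_add, ha, hb, hd, hcc, add_assoc, Nat.reduceAdd] at h0 h1 h2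
    rw [Function.iterate_succ_apply', ih (by omega),
      gdStep_eq (w14_ne_zero 1) (w14_ne_zero 2) (w14_ne_zero 3) (hne _ (by omega))
        (hne _ (by omega)) (hne _ (by omega)) h0 h1
        (x4 := toField (r (3 * n + 12))) (by linear_combination h2)]
    simp only [mul_add, mul_one, add_assoc, Nat.reduceAdd]

end GDLaurent

/-- iterating the ten-dimensional Gel'fand-Dikii map from generic
(indeterminate) initial data, all iterates are well defined (the quantities `b`, `c`, `d`,
`x_n`, `y_n`, `z_{n+1}` entering the denominators are nonzero), and all entries of every
iterate lie in the Laurent polynomial subring `gdLaurentRing`. -/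
theorem stmt_5 :
    (w14 1 ≠ 0 ∧ w14 2 ≠ 0 ∧ w14 3 ≠ 0) ∧
    ∀ n : ℕ,
      ((GDStep (w14 0) (w14 1) (w14 2) (w14 3))^[n]
          (⟨w14 4, w14 5, w14 6, w14 7, w14 8, w14 9, w14 10, w14 11, w14 12, w14 13⟩ :
            GDState RatFuncField14)).x0 ≠ 0 ∧
      ((GDStep (w14 0) (w14 1) (w14 2) (w14 3))^[n]
          ⟨w14 4, w14 5, w14 6, w14 7, w14 8, w14 9, w14 10, w14 11, w14 12, w14 13⟩).y0 ≠ 0 ∧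
      ((GDStep (w14 0) (w14 1) (w14 2) (w14 3))^[n]
          ⟨w14 4, w14 5, w14 6, w14 7, w14 8, w14 9, w14 10, w14 11, w14 12, w14 13⟩).z1 ≠ 0 ∧
      ((GDStep (w14 0) (w14 1) (w14 2) (w14 3))^[n]
          ⟨w14 4, w14 5, w14 6, w14 7, w14 8, w14 9, w14 10, w14 11, w14 12, w14 13⟩).x0
        ∈ gdLaurentRing ∧
      ((GDStep (w14 0) (w14 1) (w14 2) (w14 3))^[n]
          ⟨w14 4, w14 5, w14 6, w14 7, w14 8, w14 9, w14 10, w14 11, w14 12, w14 13⟩).y0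
        ∈ gdLaurentRing ∧
      ((GDStep (w14 0) (w14 1) (w14 2) (w14 3))^[n]
          ⟨w14 4, w14 5, w14 6, w14 7, w14 8, w14 9, w14 10, w14 11, w14 12, w14 13⟩).z1
        ∈ gdLaurentRing := by
  refine ⟨⟨GDLaurent.w14_ne_zero 1, GDLaurent.w14_ne_zero 2, GDLaurent.w14_ne_zero 3⟩, fun n => ?_⟩
  obtain ⟨r, hr⟩ := GDLaurent.exists_isUniversal (3 * n)
  have hne : ∀ j < 3 * n + 10, GDLaurent.toField (r j) ≠ 0 := fun j hj =>
    (map_ne_zero_iff _ GDLaurent.toField_injective).2 (hr.ne_zero hj)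
  rw [hr.iterate_gdStep n le_rfl]
  exact ⟨hne _ (by omega), hne _ (by omega), hne _ (by omega), GDLaurent.toField_mem _,
    GDLaurent.toField_mem _, GDLaurent.toField_mem _⟩
end

section
/- Let a ∈ ℤ, let b, c, d ∈ {1, −1}, and let the initial values x0, x1, x2, x3, y0, y1, y2, z1, z2, z3 all lie in {1, −1}. Suppose rational sequences (x_n), (y_n), (z_n) are generated from these initial values by the recurrences y_{n+3} = ((a+b)·x_{n+3}·y_n − a·x_{n+2}·y_{n+1})/(b·x_n), z_{n+4} = ((a+d)·y_{n+3}·z_{n+1} − a·y_{n+2}·z_{n+2})/(d·y_n), x_{n+4} = ((a+c)·x_{n+1}·z_{n+4} − a·x_{n+2}·z_{n+3})/(c·z_{n+1}) for all n ≥ 0, and that every denominator encountered is nonzero (so the sequences are well defined). Then all terms x_n, y_n, z_n are integers. -/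
/-- The order ten recurrence with three-periodic coefficients obtained by interlacing the three
sequences `x`, `y`, `z`, imposed only up to the index `N`. -/
def IsSolUpTo {S : Type} [CommRing S] (β w : ℕ → S) (N : ℕ) : Prop :=
  ∀ m, m + 10 ≤ N →
    w (m + 10) * w m = (1 + β m) * w (m + 9) * w (m + 1) - β m * w (m + 6) * w (m + 4)

/-- Over every commutative ring, unit initial values extend to a solution up to the index `N`. -/
def SolvableUpTo (N : ℕ) : Prop :=
  ∀ (S : Type) [CommRing S] (β u : ℕ → S), (∀ m, β (m + 3) = β m) → (∀ i < 10, IsUnit (u i)) →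
    ∃ w : ℕ → S, (∀ i < 10, w i = u i) ∧ IsSolUpTo β w N

/-- `β`, `u` are universal among three-periodic coefficients and unit initial values. -/
def IsUniversal {R : Type} [CommRing R] (β u : ℕ → R) : Prop :=
  ∀ (S : Type) [CommRing S] (β' u' : ℕ → S), (∀ m, β' (m + 3) = β' m) →
    (∀ i < 10, IsUnit (u' i)) → ∃ φ : R →+* S, (∀ m, φ (β m) = β' m) ∧ ∀ i < 10, φ (u i) = u' i

lemma IsSolUpTo.mono {S : Type} [CommRing S] {β w : ℕ → S} {M N : ℕ} (h : IsSolUpTo β w N)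
    (hMN : M ≤ N) : IsSolUpTo β w M :=
  fun m hm => h m (hm.trans hMN)

lemma IsSolUpTo.map {R S : Type} [CommRing R] [CommRing S] {β w : ℕ → R} {N : ℕ}
    (h : IsSolUpTo β w N) (φ : R →+* S) : IsSolUpTo (fun m => φ (β m)) (fun m => φ (w m)) N := by
  intro m hm
  simpa using congrArg φ (h m hm)

lemma SolvableUpTo.mono {M N : ℕ} (h : SolvableUpTo N) (hMN : M ≤ N) : SolvableUpTo M := by
  intro S _ β u hβ hu
  obtain ⟨w, hw, hs⟩ := h S β u hβ hu
  exact ⟨w, hw, hs.mono hMN⟩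

/-- Solutions agree as long as the denominators do not vanish. -/
lemma IsSolUpTo.eq_of_initial {S : Type} [CommRing S] [IsDomain S] {β w v : ℕ → S} {N L : ℕ}
    (hw : IsSolUpTo β w N) (hv : IsSolUpTo β v N) (hne : ∀ m, m + 10 ≤ L → w m ≠ 0)
    (hLN : L ≤ N) (hi : ∀ i < 10, v i = w i) : ∀ m ≤ L, v m = w m := by
  intro m
  induction m using Nat.strong_induction_on with
  | _ m ih =>
    intro hm
    by_cases h10 : m < 10
    · exact hi m h10
    · obtain ⟨n, rfl⟩ : ∃ n, m = n + 10 := ⟨m - 10, by omega⟩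
      have h1 := hw n (by omega)
      have h2 := hv n (by omega)
      rw [ih n (by omega) (by omega), ih (n + 9) (by omega) (by omega),
        ih (n + 1) (by omega) (by omega), ih (n + 6) (by omega) (by omega),
        ih (n + 4) (by omega) (by omega), ← h1] at h2
      exact mul_right_cancel₀ (hne n hm) h2

/-- Solvability from the window of initial values starting at `s` yields a divisibility of the next
numerator, up to powers of an element inverting that window. -/
lemma exists_mul_pow_eq_of_window {R : Type} [CommRing R] [IsDomain R] {β w : ℕ → R} {s t : ℕ}
    (ht : SolvableUpTo (t + 10)) (hβ : ∀ m, β (m + 3) = β m)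
    (hw : IsSolUpTo β w (s + t + 9)) (hne : ∀ m ≤ s + t + 9, w m ≠ 0) {a : R} (ha : a ≠ 0)
    (hwin : ∀ i < 10, IsUnit (w (s + i)) ∨ w (s + i) ∣ a) :
    ∃ (k : ℕ) (r : R),
      ((1 + β (s + t)) * w (s + t + 9) * w (s + t + 1) - β (s + t) * w (s + t + 6) * w (s + t + 4))
        * a ^ k = w (s + t) * r := by
  have hinj : Function.Injective (algebraMap R (Localization.Away a)) :=
    IsLocalization.injective _ (powers_le_nonZeroDivisors_of_noZeroDivisors ha)
  have : IsDomain (Localization.Away a) := IsLocalization.Away.isDomain _ ha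
  set f := algebraMap R (Localization.Away a) with hf
  obtain ⟨v, hv0, hv⟩ := ht (Localization.Away a) (fun m => f (β (s + m))) (fun m => f (w (s + m)))
    (fun m => by rw [← hβ (s + m)]; rfl)
    (fun i hi => by
      rcases hwin i hi with h | h
      · exact h.map f
      · exact isUnit_of_dvd_unit (map_dvd f h) (IsLocalization.Away.algebraMap_isUnit a))
  have hsh : IsSolUpTo (fun m => f (β (s + m))) (fun m => f (w (s + m))) (t + 9) := by
    intro m hm
    simpa [add_assoc] using congrArg f (hw (s + m) (by omega))
  have hagree := hsh.eq_of_initial (hv.mono (by omega)) (L := t + 9)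
    (fun m hm => by
      rw [Ne, map_eq_zero_iff f hinj]
      exact hne _ (by omega)) le_rfl hv0
  have hrec := hv t le_rfl
  rw [hagree t (by omega), hagree (t + 9) (by omega), hagree (t + 1) (by omega),
    hagree (t + 6) (by omega), hagree (t + 4) (by omega)] at hrec
  obtain ⟨k, r, hkr⟩ := IsLocalization.Away.surj a (v (t + 10))
  refine ⟨k, r, hinj ?_⟩
  simp only [← add_assoc] at hrec
  simp only [map_mul, map_sub, map_add, map_one, map_pow]
  rw [← hf] at hkr
  linear_combination (-(f a) ^ k) * hrec + f (w (s + t)) * hkr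

/-- Two coprime denominators leave no denominator at all. -/
lemma dvd_of_mul_pow_eq {R : Type} [CommRing R] [IsDomain R] {p q g E r s : R} {k l : ℕ}
    (hp : Prime p) (hpq : ¬ p ∣ q) (hg : g ≠ 0) (h1 : E * p ^ k = g * r) (h2 : E * q ^ l = g * s) :
    g ∣ E := by
  have h3 : p ^ k * s = q ^ l * r := mul_left_cancel₀ hg (by
    linear_combination q ^ l * h1 - p ^ k * h2)
  obtain ⟨t, rfl⟩ : p ^ k ∣ r :=
    hp.pow_dvd_of_dvd_mul_left k (fun h => hpq (hp.dvd_of_dvd_pow h)) ⟨s, h3.symm⟩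
  refine ⟨t, mul_right_cancel₀ (pow_ne_zero k hp.ne_zero) ?_⟩
  linear_combination h1

/-- Specialising the coefficients and the initial values of a universal solution. -/
lemma IsUniversal.exists_sol {R S : Type} [CommRing R] [CommRing S] {β u w : ℕ → R} {N : ℕ}
    (hU : IsUniversal β u) (hw0 : ∀ i < 10, w i = u i) (hw : IsSolUpTo β w N)
    (β' u' : ℕ → S) (hβ : ∀ m, β' (m + 3) = β' m) (hu : ∀ i < 10, IsUnit (u' i)) :
    ∃ φ : R →+* S, (∀ m, φ (β m) = β' m) ∧ (∀ i < 10, φ (w i) = u' i) ∧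
      IsSolUpTo β' (fun m => φ (w m)) N := by
  obtain ⟨φ, h1, h2⟩ := hU S β' u' hβ hu
  refine ⟨φ, h1, fun i hi => by rw [hw0 i hi, h2 i hi], ?_⟩
  have := hw.map φ
  simpa only [h1] using this

lemma IsUniversal.solvableUpTo {R : Type} [CommRing R] {β u w : ℕ → R} {N : ℕ}
    (hU : IsUniversal β u) (hw0 : ∀ i < 10, w i = u i) (hw : IsSolUpTo β w N) :
    SolvableUpTo N := by
  intro S _ β' u' hβ hu
  obtain ⟨φ, -, h2, h3⟩ := hU.exists_sol hw0 hw β' u' hβ hu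
  exact ⟨_, h2, h3⟩

/-- A universal solution has no vanishing term, as it specialises to the constant solution. -/
lemma IsUniversal.ne_zero {R : Type} [CommRing R] {β u w : ℕ → R} {N : ℕ}
    (hU : IsUniversal β u) (hw0 : ∀ i < 10, w i = u i) (hw : IsSolUpTo β w N) :
    ∀ m ≤ N, w m ≠ 0 := by
  obtain ⟨φ, -, h2, h3⟩ := hU.exists_sol hw0 hw (fun _ => (0 : ℤ)) (fun _ => 1) (fun _ => rfl)
    (fun _ _ => isUnit_one)
  have h4 : IsSolUpTo (fun _ => (0 : ℤ)) (fun _ => 1) N := fun m _ => by simp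
  have h5 := h4.eq_of_initial h3 (fun _ _ => one_ne_zero) le_rfl h2
  intro m hm h0
  have := h5 m hm
  simp [h0] at this

/-- The first genuine division: `w 10` divides the numerator of `w 20`, with an explicit
quotient. -/
lemma IsSolUpTo.numerator_twenty {S : Type} [CommRing S] {β w : ℕ → S} (h : IsSolUpTo β w 19)
    (hβ : ∀ m, β (m + 3) = β m) :
    ((1 + β 10) * w 19 * w 11 - β 10 * w 16 * w 14) * (w 1 * w 4 * w 6 * w 9) =
      w 10 * ((1 + β 1) * w 4 * w 6 * ((1 + β 0) * w 18 *
        ((1 + β 1) * w 10 * w 2 - β 1 * w 7 * w 5) - β 0 * w 15 * w 13 * (1 + β 1) * w 2)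
      - β 1 * w 9 * w 1 * (-β 0 * w 12 * ((1 + β 1) * w 13 * w 5 - β 1 * w 10 * w 8)
        - (1 + β 0) * w 15 * w 7 * β 1 * w 8)
      - (1 + β 1) * β 1 * w 15 * w 13 * w 7 * w 5 * w 0) := by
  have h0 := h 0 (by norm_num)
  have h1 := h 1 (by norm_num)
  have h4 := h 4 (by norm_num)
  have h6 := h 6 (by norm_num)
  have h9 := h 9 (by norm_num)
  have e10 : β 10 = β 1 := ((hβ 7).trans (hβ 4)).trans (hβ 1)
  have e4 : β 4 = β 1 := hβ 1
  have e6 : β 6 = β 0 := (hβ 3).trans (hβ 0)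
  have e9 : β 9 = β 0 := (hβ 6).trans e6
  norm_num at h0 h1 h4 h6 h9
  rw [e4] at h4
  rw [e6] at h6
  rw [e9] at h9
  rw [e10]
  linear_combination (1 + β 1) * w 4 * w 6 * (w 11 * w 1 * h9
      + ((1 + β 0) * w 18 * w 10 - β 0 * w 15 * w 13) * h1)
    - β 1 * w 9 * w 1 * (w 14 * w 4 * h6 + ((1 + β 0) * w 15 * w 7 - β 0 * w 12 * w 10) * h4)
    + (1 + β 1) * β 1 * w 15 * w 13 * w 7 * w 5 * h0

/-- A solution extends by one step as soon as the division is possible. -/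
lemma exists_extend {S : Type} [CommRing S] {β u w : ℕ → S} {n : ℕ} (hw0 : ∀ i < 10, w i = u i)
    (hw : IsSolUpTo β w (n + 9))
    (hdvd : w n ∣ (1 + β n) * w (n + 9) * w (n + 1) - β n * w (n + 6) * w (n + 4)) :
    ∃ v : ℕ → S, (∀ i < 10, v i = u i) ∧ IsSolUpTo β v (n + 10) := by
  obtain ⟨e, he⟩ := hdvd
  have key : ∀ m < n + 10, Function.update w (n + 10) e m = w m :=
    fun m hm => Function.update_of_ne (by omega) _ _
  refine ⟨Function.update w (n + 10) e, fun i hi => by rw [key i (by omega), hw0 i hi], ?_⟩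
  intro m hm
  rw [key m (by omega), key (m + 9) (by omega), key (m + 1) (by omega), key (m + 6) (by omega),
    key (m + 4) (by omega)]
  rcases Nat.lt_or_ge m n with h | h
  · rw [key (m + 10) (by omega)]
    exact hw m (by omega)
  · obtain rfl : m = n := by omega
    rw [Function.update_self]
    linear_combination -he

/-- With unit initial values the first ten steps need no genuine division. -/
lemma exists_sol_of_isUnit {S : Type} [CommRing S] (β u : ℕ → S) (hu : ∀ i < 10, IsUnit (u i)) :
    ∀ n ≤ 10, ∃ w : ℕ → S, (∀ i < 10, w i = u i) ∧ IsSolUpTo β w (n + 9) := by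
  intro n
  induction n with
  | zero => exact fun _ => ⟨u, fun _ _ => rfl, fun m hm => by omega⟩
  | succ n ih =>
    intro hn
    obtain ⟨w, hw0, hw⟩ := ih (by omega)
    obtain ⟨c, hc⟩ := (hu n (by omega)).exists_left_inv
    exact exists_extend hw0 hw ⟨c * ((1 + β n) * w (n + 9) * w (n + 1)
      - β n * w (n + 6) * w (n + 4)), by
        rw [hw0 n (by omega)]
        linear_combination
          (-((1 + β n) * w (n + 9) * w (n + 1) - β n * w (n + 6) * w (n + 4))) * hc⟩

/-- The element `C r * X - 1` is prime over a domain when `r ≠ 0`: the quotient is a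
localization. -/
lemma prime_C_mul_X_sub_one {B : Type} [CommRing B] [IsDomain B] {r : B} (hr : r ≠ 0) :
    Prime (Polynomial.C r * Polynomial.X - 1 : Polynomial B) := by
  have hne : (Polynomial.C r * Polynomial.X - 1 : Polynomial B) ≠ 0 := by
    intro h
    simpa using congrArg (Polynomial.eval 0) h
  have : IsDomain (Localization.Away r) := IsLocalization.Away.isDomain _ hr
  have hdom : IsDomain (AdjoinRoot (Polynomial.C r * Polynomial.X - 1 : Polynomial B)) :=
    (Localization.awayEquivAdjoin r).symm.toMulEquiv.isDomain _
  rw [← Ideal.span_singleton_prime hne]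
  exact (Ideal.Quotient.isDomain_iff_prime _).1 hdom

/-- A Laurent polynomial domain with universal coefficients and unit initial values, in which the
first new term is prime. -/
lemma exists_universal :
    ∃ (R : Type) (_ : CommRing R) (_ : IsDomain R) (β u : ℕ → R), (∀ m, β (m + 3) = β m) ∧
      (∀ i < 10, IsUnit (u i)) ∧ IsUniversal β u ∧
      ∀ p, p * u 0 = (1 + β 0) * u 9 * u 1 - β 0 * u 6 * u 4 → Prime p := by
  set M : MvPolynomial ℕ ℤ := ∏ i ∈ Finset.range 10, MvPolynomial.X i with hM
  have hM0 : M ≠ 0 := Finset.prod_ne_zero_iff.2 fun i _ => MvPolynomial.X_ne_zero i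
  let B := Localization.Away M
  have : IsDomain B := IsLocalization.Away.isDomain _ hM0
  let U : ℕ → B := fun i => algebraMap (MvPolynomial ℕ ℤ) B (MvPolynomial.X i)
  have hU : ∀ i < 10, IsUnit (U i) := fun i hi =>
    isUnit_of_dvd_unit (map_dvd _ (Finset.dvd_prod_of_mem _ (Finset.mem_range.2 hi)))
      (IsLocalization.Away.algebraMap_isUnit M)
  have lift : ∀ (S : Type) [CommRing S] (g : ℕ → S), (∀ i < 10, IsUnit (g i)) →
      ∃ φ : B →+* S, ∀ i, φ (U i) = g i := by
    intro S _ g hg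
    have hunit : IsUnit ((MvPolynomial.aeval g : MvPolynomial ℕ ℤ →ₐ[ℤ] S).toRingHom M) := by
      have : (MvPolynomial.aeval g : MvPolynomial ℕ ℤ →ₐ[ℤ] S).toRingHom M
          = ∏ i ∈ Finset.range 10, g i := by
        simp [hM]
      rw [this]
      exact (IsUnit.prod_iff).2 fun i hi => hg i (Finset.mem_range.1 hi)
    refine ⟨IsLocalization.Away.lift M hunit, fun i => ?_⟩
    simp only [U]
    rw [IsLocalization.Away.lift_eq]
    simp
  refine ⟨Polynomial B, inferInstance, inferInstance,
    fun m => if m % 3 = 0 then Polynomial.X else Polynomial.C (U (9 + m % 3)),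
    fun i => Polynomial.C (U i), fun m => by simp, fun i hi => (hU i hi).map Polynomial.C, ?_, ?_⟩
  · intro S _ β' u' hβ hu
    obtain ⟨φ, hφ⟩ := lift S (fun i => if i < 10 then u' i else β' (i - 9))
      (fun i hi => by simpa [hi] using hu i hi)
    have hmod : ∀ m, β' (m % 3) = β' m := fun m =>
      (show Function.Periodic β' 3 from hβ).map_mod_nat m
    refine ⟨Polynomial.eval₂RingHom φ (β' 0), fun m => ?_, fun i hi => ?_⟩
    · rw [← hmod m]
      by_cases h : m % 3 = 0
      · simp [h]
      · have h9 : ¬ 9 + m % 3 < 10 := by omega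
        simp [h, hφ, h9]
    · simp [hφ, hi]
  · intro p hp
    obtain ⟨c, hc⟩ := ((hU 9 (by norm_num)).mul (hU 1 (by norm_num))).exists_right_inv
    set r : B := c * (U 6 * U 4) - 1 with hr
    have hr0 : r ≠ 0 := by
      intro h
      obtain ⟨φ, hφ⟩ := lift ℚ (fun i => if i = 6 then 2 else 1)
        (fun i _ => by split_ifs <;> simp)
      have h1 := congrArg φ hc
      have h2 := congrArg φ (hr.symm.trans h)
      simp [hφ] at h1 h2
      rw [h1] at h2
      norm_num at h2
    have hc' : Polynomial.C (U 9) * Polynomial.C (U 1) * Polynomial.C c = (1 : Polynomial B) := by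
      rw [← Polynomial.C_mul, ← Polynomial.C_mul, hc, Polynomial.C_1]
    have h0 : IsUnit (Polynomial.C (U 0)) := (hU 0 (by norm_num)).map Polynomial.C
    have h91 : IsUnit (-(Polynomial.C (U 9) * Polynomial.C (U 1))) :=
      (((hU 9 (by norm_num)).map Polynomial.C).mul ((hU 1 (by norm_num)).map Polynomial.C)).neg
    have hmul : p * Polynomial.C (U 0)
        = (Polynomial.C r * Polynomial.X - 1) * -(Polynomial.C (U 9) * Polynomial.C (U 1)) := by
      rw [hp, hr]
      simp only [Nat.zero_mod, if_true, Polynomial.C_sub, Polynomial.C_mul, Polynomial.C_1]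
      linear_combination Polynomial.X * Polynomial.C (U 6) * Polynomial.C (U 4) * hc'
    have hassoc : Associated (Polynomial.C r * Polynomial.X - 1) p :=
      (associated_mul_unit_right _ _ h91).trans
        (hmul ▸ associated_mul_unit_left p _ h0 : Associated _ p)
    exact hassoc.prime (prime_C_mul_X_sub_one hr0)

/-- In the universal solution the prime `w 10` divides none of the ten subsequent terms. -/
lemma IsUniversal.not_dvd {R : Type} [CommRing R] [IsDomain R] {β u w : ℕ → R}
    (hU : IsUniversal β u) (hβ : ∀ m, β (m + 3) = β m) (hw0 : ∀ i < 10, w i = u i)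
    (hw : IsSolUpTo β w 20) : ∀ i < 10, ¬ w 10 ∣ w (11 + i) := by
  obtain ⟨φ, hφβ, hφ0, hφ⟩ := hU.exists_sol hw0 hw (fun _ => (1 : ℚ))
    (fun i => if i = 6 then 2 else 1) (fun _ => rfl) (fun i _ => by split_ifs <;> simp)
  have hnum := (hw.mono (by norm_num : 19 ≤ 20)).numerator_twenty hβ
  have h20 := hw 10 (by norm_num)
  norm_num at h20
  rw [← h20, mul_comm (w 20), mul_assoc] at hnum
  have hcan := congrArg φ (mul_left_cancel₀ (hU.ne_zero hw0 hw 10 (by norm_num)) hnum)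
  have v0 := hφ0 0 (by norm_num)
  have v1 := hφ0 1 (by norm_num)
  have v2 := hφ0 2 (by norm_num)
  have v3 := hφ0 3 (by norm_num)
  have v4 := hφ0 4 (by norm_num)
  have v5 := hφ0 5 (by norm_num)
  have v6 := hφ0 6 (by norm_num)
  have v7 := hφ0 7 (by norm_num)
  have v8 := hφ0 8 (by norm_num)
  have v9 := hφ0 9 (by norm_num)
  norm_num at v0 v1 v2 v3 v4 v5 v6 v7 v8 v9
  have v10 := hφ 0 (by norm_num)
  norm_num [v0, v1, v4, v6, v9] at v10
  have v11 := hφ 1 (by norm_num)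
  norm_num [v1, v2, v5, v7, v10] at v11
  have v12 := hφ 2 (by norm_num)
  norm_num [v2, v3, v6, v8, v11] at v12
  have v13 := hφ 3 (by norm_num)
  norm_num [v3, v4, v7, v9, v12] at v13
  have v14 := hφ 4 (by norm_num)
  norm_num [v4, v5, v8, v10, v13] at v14
  have v15 := hφ 5 (by norm_num)
  norm_num [v5, v6, v9, v11, v14] at v15
  have v16 := hφ 6 (by norm_num)
  norm_num [v6, v7, v10, v12, v15] at v16
  have v17 := hφ 7 (by norm_num)
  norm_num [v7, v8, v11, v13, v16] at v17
  have v18 := hφ 8 (by norm_num)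
  norm_num [v8, v9, v12, v14, v17] at v18
  have v19 := hφ 9 (by norm_num)
  norm_num [v9, v10, v13, v15, v18] at v19
  norm_num [hφβ, v0, v1, v2, v4, v5, v6, v7, v8, v9, v10, v12, v13, v15, v18] at hcan
  rintro i hi ⟨e, he⟩
  have h := congrArg φ he
  rw [map_mul, v10, zero_mul] at h
  interval_cases i <;> norm_num at h <;> linarith

/-- The Laurent phenomenon for the interlaced recurrence. -/
theorem solvableUpTo (N : ℕ) : SolvableUpTo N := by
  obtain ⟨R, _, _, β, u, hβ, hu, hU, hprime⟩ := exists_universal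
  suffices h : ∀ n, ∃ w : ℕ → R, (∀ i < 10, w i = u i) ∧ IsSolUpTo β w (n + 9) by
    obtain ⟨w, hw0, hw⟩ := h N
    exact (hU.solvableUpTo hw0 hw).mono (by omega)
  intro n
  induction n with
  | zero => exact exists_sol_of_isUnit β u hu 0 (by norm_num)
  | succ n ih =>
    obtain ⟨w, hw0, hw⟩ := ih
    have hne := hU.ne_zero hw0 hw
    rcases Nat.lt_or_ge n 10 with hn | hn
    · exact exists_sol_of_isUnit β u hu (n + 1) (by omega)
    refine exists_extend hw0 hw ?_
    have h10 : Prime (w 10) := hprime _ (by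
      have := hw 0 (by omega)
      norm_num at this
      rw [← hw0 0 (by norm_num), ← hw0 9 (by norm_num), ← hw0 1 (by norm_num),
        ← hw0 6 (by norm_num), ← hw0 4 (by norm_num), this])
    rcases hn.eq_or_lt with rfl | hn
    · obtain ⟨c, hc⟩ := (((hu 1 (by norm_num)).mul (hu 4 (by norm_num))).mul
        (hu 6 (by norm_num))).mul (hu 9 (by norm_num)) |>.exists_right_inv
      have := hw.numerator_twenty hβ
      rw [hw0 1 (by norm_num), hw0 4 (by norm_num), hw0 6 (by norm_num),
        hw0 9 (by norm_num)] at this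
      exact (IsUnit.dvd_mul_right (IsUnit.of_mul_eq_one _ hc)).1 ⟨_, this⟩
    have hS := hU.solvableUpTo hw0 hw
    obtain ⟨t, rfl⟩ : ∃ t, n = 11 + t := ⟨n - 11, by omega⟩
    have hq : ¬ w 10 ∣ ∏ i ∈ Finset.range 10, w (11 + i) := by
      rw [h10.dvd_finsetProd_iff]
      rintro ⟨i, hi, hd⟩
      exact hU.not_dvd hβ hw0 (hw.mono (by omega)) i (Finset.mem_range.1 hi) hd
    obtain ⟨k, r, hr⟩ := exists_mul_pow_eq_of_window (s := 1) (t := 10 + t) (β := β) (w := w)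
      (hS.mono (by omega)) hβ (hw.mono (by omega)) (fun m hm => hne m (by omega)) h10.ne_zero
      (fun i hi => by
        rcases Nat.lt_or_ge i 9 with h | h
        · exact Or.inl (by rw [hw0 _ (by omega)]; exact hu _ (by omega))
        · obtain rfl : i = 9 := by omega
          exact Or.inr dvd_rfl)
    obtain ⟨l, s, hs⟩ := exists_mul_pow_eq_of_window (s := 11) (t := t) (β := β) (w := w)
      (hS.mono (by omega)) hβ hw hne
      (Finset.prod_ne_zero_iff.2 fun i hi => hne (11 + i) (by have := Finset.mem_range.1 hi; omega))
      (fun i hi => Or.inr (Finset.dvd_prod_of_mem (fun i => w (11 + i)) (Finset.mem_range.2 hi)))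
    rw [show 1 + (10 + t) = 11 + t by omega] at hr
    exact dvd_of_mul_pow_eq h10 hq (hne _ (by omega)) hr hs

/-- Nonvanishing rational solutions with integer coefficients and initial values `±1` are
integral. -/
lemma exists_int_eq_of_sol (β u : ℕ → ℤ) (hβ : ∀ m, β (m + 3) = β m)
    (hu : ∀ i < 10, IsUnit (u i)) (w : ℕ → ℚ) (hw0 : ∀ i < 10, w i = u i) (hne : ∀ m, w m ≠ 0)
    (hw : ∀ N, IsSolUpTo (fun m => (β m : ℚ)) w N) (m : ℕ) : ∃ k : ℤ, w m = k := by
  obtain ⟨v, hv0, hv⟩ := solvableUpTo m ℤ β u hβ hu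
  refine ⟨v m, ((hw m).eq_of_initial (hv.map (Int.castRingHom ℚ)) (fun i _ => hne i) le_rfl
    (fun i hi => ?_) m le_rfl).symm⟩
  simp [hw0 i hi, hv0 i hi]


/-- for an integer `a`, signs `b, c, d ∈ {1, -1}` and initial values
`x0, …, x3, y0, y1, y2, z1, z2, z3 ∈ {1, -1}`, any well-defined rational solution of the
(2,1)-reduced higher Gel'fand-Dikii recurrences
`y (n+3) = ((a+b) x (n+3) y n - a x (n+2) y (n+1)) / (b x n)`,
`z (n+4) = ((a+d) y (n+3) z (n+1) - a y (n+2) z (n+2)) / (d y n)`,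
`x (n+4) = ((a+c) x (n+1) z (n+4) - a x (n+2) z (n+3)) / (c z (n+1))`
consists entirely of integers. -/
theorem stmt_6 (a b c d : ℤ)
    (hb : b = 1 ∨ b = -1) (hc : c = 1 ∨ c = -1) (hd : d = 1 ∨ d = -1)
    (X0 X1 X2 X3 Y0 Y1 Y2 Z1 Z2 Z3 : ℤ)
    (hX0 : X0 = 1 ∨ X0 = -1) (hX1 : X1 = 1 ∨ X1 = -1) (hX2 : X2 = 1 ∨ X2 = -1)
    (hX3 : X3 = 1 ∨ X3 = -1) (hY0 : Y0 = 1 ∨ Y0 = -1) (hY1 : Y1 = 1 ∨ Y1 = -1)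
    (hY2 : Y2 = 1 ∨ Y2 = -1) (hZ1 : Z1 = 1 ∨ Z1 = -1) (hZ2 : Z2 = 1 ∨ Z2 = -1)
    (hZ3 : Z3 = 1 ∨ Z3 = -1)
    (x y z : ℕ → ℚ)
    (hx0 : x 0 = (X0 : ℚ)) (hx1 : x 1 = (X1 : ℚ)) (hx2 : x 2 = (X2 : ℚ))
    (hx3 : x 3 = (X3 : ℚ))
    (hy0 : y 0 = (Y0 : ℚ)) (hy1 : y 1 = (Y1 : ℚ)) (hy2 : y 2 = (Y2 : ℚ))
    (hz1 : z 1 = (Z1 : ℚ)) (hz2 : z 2 = (Z2 : ℚ)) (hz3 : z 3 = (Z3 : ℚ))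
    (hxne : ∀ n : ℕ, x n ≠ 0) (hyne : ∀ n : ℕ, y n ≠ 0) (hzne : ∀ n : ℕ, z (n + 1) ≠ 0)
    (hrecY : ∀ n : ℕ,
      y (n + 3) =
        (((a : ℚ) + (b : ℚ)) * x (n + 3) * y n - (a : ℚ) * x (n + 2) * y (n + 1)) /
          ((b : ℚ) * x n))
    (hrecZ : ∀ n : ℕ,
      z (n + 4) =
        (((a : ℚ) + (d : ℚ)) * y (n + 3) * z (n + 1) - (a : ℚ) * y (n + 2) * z (n + 2)) /
          ((d : ℚ) * y n))
    (hrecX : ∀ n : ℕ,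
      x (n + 4) =
        (((a : ℚ) + (c : ℚ)) * x (n + 1) * z (n + 4) - (a : ℚ) * x (n + 2) * z (n + 3)) /
          ((c : ℚ) * z (n + 1))) :
    ∀ n : ℕ,
      (∃ k : ℤ, x n = (k : ℚ)) ∧ (∃ k : ℤ, y n = (k : ℚ)) ∧ (∃ k : ℤ, z (n + 1) = (k : ℚ)) := by
  have hsq : ∀ e : ℤ, e = 1 ∨ e = -1 → (e : ℚ) * e = 1 := by
    rintro e (rfl | rfl) <;> norm_num
  have hbq := hsq b hb
  have hcq := hsq c hc
  have hdq := hsq d hd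
  let w : ℕ → ℚ := fun m =>
    if m % 3 = 0 then x (m / 3) else if m % 3 = 1 then y (m / 3) else z (m / 3 + 1)
  let β : ℕ → ℤ := fun m => if m % 3 = 0 then a * b else if m % 3 = 1 then a * d else a * c
  let u : ℕ → ℤ := fun m =>
    if m = 0 then X0 else if m = 1 then Y0 else if m = 2 then Z1 else if m = 3 then X1 else
    if m = 4 then Y1 else if m = 5 then Z2 else if m = 6 then X2 else if m = 7 then Y2 else
    if m = 8 then Z3 else X3
  have wx : ∀ n, w (3 * n) = x n := fun n => by simp [w]
  have wy : ∀ n, w (3 * n + 1) = y n := fun n => by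
    simp [w, Nat.mul_add_div]
  have wz : ∀ n, w (3 * n + 2) = z (n + 1) := fun n => by
    simp [w, Nat.mul_add_div]
  have hint : ∀ m, ∃ k : ℤ, w m = k := by
    refine exists_int_eq_of_sol β u (fun m => by simp [β]) ?_ w ?_ ?_ ?_
    · intro i hi
      rw [Int.isUnit_iff]
      interval_cases i <;> simpa [u]
    · intro i hi
      interval_cases i <;> simpa [u, w]
    · intro m
      simp only [w]
      split_ifs
      exacts [hxne _, hyne _, hzne _]
    · intro N m _
      obtain ⟨n, rfl | rfl | rfl⟩ : ∃ n, m = 3 * n ∨ m = 3 * n + 1 ∨ m = 3 * n + 2 :=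
        ⟨m / 3, by omega⟩
      · have hb0 : (b : ℚ) ≠ 0 := left_ne_zero_of_mul_eq_one hbq
        have h := hrecY n
        rw [eq_div_iff (mul_ne_zero hb0 (hxne n))] at h
        have e : ((β (3 * n) : ℤ) : ℚ) = a * b := by simp [β]
        have w10 : w (3 * n + 10) = y (n + 3) := wy (n + 3)
        have w9 : w (3 * n + 9) = x (n + 3) := wx (n + 3)
        have w6 : w (3 * n + 6) = x (n + 2) := wx (n + 2)
        have w4 : w (3 * n + 4) = y (n + 1) := wy (n + 1)
        beta_reduce
        rw [e, w10, w9, w6, w4, wx, wy]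
        linear_combination (b : ℚ) * h + (x (n + 3) * y n - y (n + 3) * x n) * hbq
      · have hd0 : (d : ℚ) ≠ 0 := left_ne_zero_of_mul_eq_one hdq
        have h := hrecZ n
        rw [eq_div_iff (mul_ne_zero hd0 (hyne n))] at h
        have e : ((β (3 * n + 1) : ℤ) : ℚ) = a * d := by simp [β]
        have w10 : w (3 * n + 1 + 10) = z (n + 4) := wz (n + 3)
        have w9 : w (3 * n + 1 + 9) = y (n + 3) := wy (n + 3)
        have w6 : w (3 * n + 1 + 6) = y (n + 2) := wy (n + 2)
        have w4 : w (3 * n + 1 + 4) = z (n + 2) := wz (n + 1)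
        beta_reduce
        rw [e, w10, w9, w6, w4, wy, wz]
        linear_combination (d : ℚ) * h + (y (n + 3) * z (n + 1) - z (n + 4) * y n) * hdq
      · have hc0 : (c : ℚ) ≠ 0 := left_ne_zero_of_mul_eq_one hcq
        have h := hrecX n
        rw [eq_div_iff (mul_ne_zero hc0 (hzne n))] at h
        have e : ((β (3 * n + 2) : ℤ) : ℚ) = a * c := by simp [β]
        have w10 : w (3 * n + 2 + 10) = x (n + 4) := wx (n + 4)
        have w9 : w (3 * n + 2 + 9) = z (n + 4) := wz (n + 3)
        have w6 : w (3 * n + 2 + 6) = z (n + 3) := wz (n + 2)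
        have w4 : w (3 * n + 2 + 4) = x (n + 2) := wx (n + 2)
        have w1 : w (3 * n + 2 + 1) = x (n + 1) := wx (n + 1)
        beta_reduce
        rw [e, w10, w9, w6, w4, w1, wz]
        linear_combination (c : ℚ) * h + (x (n + 1) * z (n + 4) - x (n + 4) * z (n + 1)) * hcq
  intro n
  refine ⟨?_, ?_, ?_⟩
  · simpa only [wx] using hint (3 * n)
  · simpa only [wy] using hint (3 * n + 1)
  · simpa only [wz] using hint (3 * n + 2)
end
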